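/- arXiv:2503.03343 — 2 statements merged into one kernel-verified Lean document; each statement's English description precedes it below -/
import Mathlib

section
/- Let r̄ > r_c. Then there exists a constant Λ ≥ 1, depending only on N, m, p, σ and r̄, such that for all real numbers r₁, r with r_c ≤ r₁ ≤ r ≤ r̄ the following holds: for every nonnegative function w : ℝᴺ → ℝ such that ∫_{ℝᴺ} w(x)^{r₁+1} dx < ∞ and such that W := w^{(m+r)/2} is continuously differentiable on ℝᴺ with ∫_{ℝᴺ} ‖∇W(x)‖² dx < ∞, one has ∫_{ℝᴺ} |x|^σ w(x)^{p+r} dx ≤ Λ · (∫_{ℝᴺ} ‖∇W(x)‖² dx)^{ω_r} · (∫_{ℝᴺ} w(x)^{r₁+1} dx)^{μ_r}. -/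
open MeasureTheory

lemma aux_holder_pow {α : Type*} [MeasurableSpace α] (μ : Measure α) {A B : ℝ}
    (h : B.HolderConjugate A) {u v : α → ENNReal} (hu : AEMeasurable u μ) (hv : AEMeasurable v μ) :
    (∫⁻ a, u a * v a ∂μ) ^ A ≤ (∫⁻ a, u a ^ B ∂μ) ^ (A / B) * ∫⁻ a, v a ^ A ∂μ := by
  have h1 := ENNReal.lintegral_mul_le_Lp_mul_Lq μ h hu hv
  have hA := h.symm.pos
  calc (∫⁻ a, u a * v a ∂μ) ^ A
      ≤ ((∫⁻ a, u a ^ B ∂μ) ^ (1 / B) * (∫⁻ a, v a ^ A ∂μ) ^ (1 / A)) ^ A :=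
        ENNReal.rpow_le_rpow h1 hA.le
    _ = _ := by
        rw [ENNReal.mul_rpow_of_nonneg _ _ hA.le, ← ENNReal.rpow_mul, ← ENNReal.rpow_mul,
          one_div_mul_cancel hA.ne', ENNReal.rpow_one]
        congr 2; ring

lemma aux_lintegral_smul {N : ℕ} (f : EuclideanSpace ℝ (Fin N) → ENNReal) {c : ℝ} (hc : 0 < c) :
    ∫⁻ x, f (c • x) = ENNReal.ofReal (c ^ (-(N : ℝ))) * ∫⁻ x, f x := by
  have h := Measure.map_addHaar_smul (volume : Measure (EuclideanSpace ℝ (Fin N))) hc.ne'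
  have h2 : ∫⁻ x, f x ∂(Measure.map (fun x : EuclideanSpace ℝ (Fin N) => c • x) volume)
      = ∫⁻ x, f (c • x) :=
    lintegral_map_equiv f (MeasurableEquiv.smul₀ c hc.ne')
  rw [← h2, h, lintegral_smul_measure, smul_eq_mul]
  congr 2
  rw [finrank_euclideanSpace_fin, abs_of_nonneg (by positivity), Real.rpow_neg hc.le,
    Real.rpow_natCast]

lemma aux_norm_pow {N : ℕ} (hN : 1 ≤ N) {κ : ℝ} (hκ : -(N : ℝ) < κ) :
    ∫⁻ x in Metric.ball (0 : EuclideanSpace ℝ (Fin N)) 1, ENNReal.ofReal (‖x‖ ^ κ) < ⊤ := by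
  have h : IntegrableOn (fun x : EuclideanSpace ℝ (Fin N) => ‖x‖ ^ κ) (Metric.ball 0 1) volume := by
    refine integrableOn_ball_of_norm_le_rpow (C := 1) (α := -κ) (by simpa using hN)
      (by simp; linarith) (Filter.Eventually.of_forall fun x => ?_) ?_
    · simp [abs_of_nonneg (Real.rpow_nonneg (norm_nonneg x) κ)]
    · exact (measurable_norm.pow_const κ).aestronglyMeasurable
  exact h.lintegral_lt_top

lemma aux_rpow_Ioo {κ : ℝ} (hκ : -1 < κ) :
    ∫⁻ t in Set.Ioo (0 : ℝ) 1, ENNReal.ofReal (t ^ κ) < ⊤ :=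
  ((intervalIntegral.integrableOn_Ioo_rpow_iff one_pos).2 hκ).lintegral_lt_top

lemma aux_T {N : ℕ} {A : ℝ} (hA : 2 ≤ A) (hA2 : A * ((N : ℝ) - 2) < 2 * N)
    (B : Set (EuclideanSpace ℝ (Fin N))) (hB : volume B ≠ ⊤) :
    ∃ C : ENNReal, C < ⊤ ∧ ∀ g : EuclideanSpace ℝ (Fin N) → ENNReal, Measurable g →
      ∫⁻ x, g x ^ (2 : ℝ) ≤ 1 →
      ∫⁻ x, (∫⁻ t in Set.Ioo (0 : ℝ) 1, ∫⁻ y in B, g (x + t • y)) ^ A ≤ C := by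
  set α : ℝ := (N * (A - 2) / (2 * A) + 1) / 2 - 1 / A with hα
  have hA0 : 0 < A := by linarith
  have hαA : α * A = (N * (A - 2) / 2 + A) / 2 - 1 := by rw [hα]; field_simp
  set A' : ℝ := A / (A - 1) with hA'
  have hconj : A'.HolderConjugate A := (Real.HolderConjugate.conjExponent (by linarith)).symm
  have h1 : -1 < -α * A' := by
    have : α * A' < 1 := by
      rw [hA', ← mul_div_assoc, div_lt_one (by linarith), hαA]; nlinarith
    linarith
  have h2 : -1 < α * A - N * (A / 2 - 1) := by rw [hαA]; nlinarith
  refine ⟨(∫⁻ t in Set.Ioo (0 : ℝ) 1, ENNReal.ofReal (t ^ (-α * A'))) ^ (A / A') *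
    (volume B ^ (A / 2 + 1) *
      ∫⁻ t in Set.Ioo (0 : ℝ) 1, ENNReal.ofReal (t ^ (α * A - N * (A / 2 - 1)))), ?_, ?_⟩
  · refine ENNReal.mul_lt_top (ENNReal.rpow_lt_top_of_nonneg ?_ (aux_rpow_Ioo h1).ne)
      (ENNReal.mul_lt_top (ENNReal.rpow_lt_top_of_nonneg (by linarith) hB) (aux_rpow_Ioo h2))
    exact div_nonneg hA0.le hconj.nonneg
  intro g hg hg1
  have hgm : Measurable fun q : (EuclideanSpace ℝ (Fin N) × ℝ) × EuclideanSpace ℝ (Fin N) =>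
      g (q.1.1 + q.1.2 • q.2) := hg.comp (by fun_prop)
  -- measurability of H
  have hH : Measurable fun q : EuclideanSpace ℝ (Fin N) × ℝ => ∫⁻ y in B, g (q.1 + q.2 • y) :=
    hgm.lintegral_prod_right'
  have hHx : ∀ x, Measurable fun t : ℝ => ∫⁻ y in B, g (x + t • y) := fun x =>
    hH.comp (by fun_prop : Measurable fun t : ℝ => (x, t))
  have hHt : ∀ t : ℝ, Measurable fun x => ∫⁻ y in B, g (x + t • y) := fun t =>
    hH.comp (by fun_prop : Measurable fun x : EuclideanSpace ℝ (Fin N) => (x, t))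
  -- Hölder in t
  have step1 : ∀ x, (∫⁻ t in Set.Ioo (0 : ℝ) 1, ∫⁻ y in B, g (x + t • y)) ^ A ≤
      (∫⁻ t in Set.Ioo (0 : ℝ) 1, ENNReal.ofReal (t ^ (-α * A'))) ^ (A / A') *
      ∫⁻ t in Set.Ioo (0 : ℝ) 1, ENNReal.ofReal (t ^ (α * A)) *
        (∫⁻ y in B, g (x + t • y)) ^ A := by
    intro x
    have := aux_holder_pow (volume.restrict (Set.Ioo (0 : ℝ) 1)) hconj
      (u := fun t => ENNReal.ofReal (t ^ (-α)))
      (v := fun t => ENNReal.ofReal (t ^ α) * ∫⁻ y in B, g (x + t • y))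
      (by fun_prop) ((by fun_prop : Measurable fun t : ℝ => ENNReal.ofReal (t ^ α)).mul
        (hHx x)).aemeasurable
    calc _ = (∫⁻ t in Set.Ioo (0 : ℝ) 1, ENNReal.ofReal (t ^ (-α)) *
          (ENNReal.ofReal (t ^ α) * ∫⁻ y in B, g (x + t • y))) ^ A := by
          congr 1
          refine setLIntegral_congr_fun measurableSet_Ioo fun t ht => ?_
          rw [← mul_assoc, ← ENNReal.ofReal_mul (Real.rpow_nonneg ht.1.le _), ← Real.rpow_add ht.1]
          simp
      _ ≤ _ := this
      _ = _ := by
          congr 1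
          · congr 1
            refine setLIntegral_congr_fun measurableSet_Ioo fun t ht => ?_
            rw [ENNReal.ofReal_rpow_of_pos (Real.rpow_pos_of_pos ht.1 _), Real.rpow_mul ht.1.le]
          · refine setLIntegral_congr_fun measurableSet_Ioo fun t ht => ?_
            rw [ENNReal.mul_rpow_of_nonneg _ _ hA0.le,
              ENNReal.ofReal_rpow_of_pos (Real.rpow_pos_of_pos ht.1 _), Real.rpow_mul ht.1.le]
  -- bound for fixed t
  have step2 : ∀ t ∈ Set.Ioo (0 : ℝ) 1, ∫⁻ x, (∫⁻ y in B, g (x + t • y)) ^ A ≤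
      volume B ^ (A / 2 + 1) * ENNReal.ofReal (t ^ (-(N * (A / 2 - 1) : ℝ))) := by
    intro t ht
    have hgt : Measurable fun q : EuclideanSpace ℝ (Fin N) × EuclideanSpace ℝ (Fin N) =>
      g (q.1 + t • q.2) := hg.comp (by fun_prop)
    have hgtx : ∀ x, Measurable fun y : EuclideanSpace ℝ (Fin N) =>
      g (x + t • y) := fun x => hg.comp (by fun_prop)
    set K : EuclideanSpace ℝ (Fin N) → ENNReal := fun x => ∫⁻ y in B, g (x + t • y) ^ (2 : ℝ)
      with hK
    have hKm : Measurable K := (hgt.pow_const _).lintegral_prod_right'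
    have c1 : ∀ x, (∫⁻ y in B, g (x + t • y)) ^ (2 : ℝ) ≤ volume B * K x := by
      intro x
      have := aux_holder_pow (volume.restrict B) (A := 2) (B := 2) (by
          constructor <;> norm_num)
        (u := fun _ => 1) (v := fun y => g (x + t • y)) (by fun_prop) (hgtx x).aemeasurable
      simpa [hK] using this
    have c2 : ∀ x, K x ≤ ENNReal.ofReal (t ^ (-(N : ℝ))) := by
      intro x
      calc K x ≤ ∫⁻ y, g (x + t • y) ^ (2 : ℝ) := setLIntegral_le_lintegral _ _
        _ = ENNReal.ofReal (t ^ (-(N : ℝ))) * ∫⁻ y, g (x + y) ^ (2 : ℝ) :=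
            aux_lintegral_smul (fun y => g (x + y) ^ (2 : ℝ)) ht.1
        _ = ENNReal.ofReal (t ^ (-(N : ℝ))) * ∫⁻ y, g y ^ (2 : ℝ) := by
            rw [lintegral_add_left_eq_self (fun y => g y ^ (2 : ℝ)) x]
        _ ≤ _ := by simpa using mul_le_mul_right hg1 (ENNReal.ofReal (t ^ (-(N : ℝ))))
    have c3 : ∫⁻ x, K x ≤ volume B := by
      rw [hK, lintegral_lintegral_swap (hgt.pow_const _).aemeasurable]
      calc ∫⁻ y in B, ∫⁻ x, g (x + t • y) ^ (2 : ℝ) = ∫⁻ y in B, ∫⁻ x, g x ^ (2 : ℝ) := by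
            congr 1; ext y
            exact lintegral_add_right_eq_self (fun x => g x ^ (2 : ℝ)) (t • y)
        _ ≤ ∫⁻ y in B, 1 := lintegral_mono fun _ => hg1
        _ = volume B := by simp
    calc ∫⁻ x, (∫⁻ y in B, g (x + t • y)) ^ A
        ≤ ∫⁻ x, (volume B ^ (A / 2) * ENNReal.ofReal (t ^ (-(N * (A / 2 - 1) : ℝ)))) * K x := by
          refine lintegral_mono fun x => ?_
          calc (∫⁻ y in B, g (x + t • y)) ^ A
              = ((∫⁻ y in B, g (x + t • y)) ^ (2 : ℝ)) ^ (A / 2) := by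
                rw [← ENNReal.rpow_mul]; congr 1; ring
            _ ≤ (volume B * K x) ^ (A / 2) := ENNReal.rpow_le_rpow (c1 x) (by linarith)
            _ = volume B ^ (A / 2) * (K x ^ (A / 2 - 1) * K x) := by
                rw [ENNReal.mul_rpow_of_nonneg _ _ (by linarith)]
                congr 1
                nth_rewrite 3 [← ENNReal.rpow_one (K x)]
                rw [← ENNReal.rpow_add_of_nonneg _ _ (by linarith) (by linarith)]
                congr 1; ring
            _ ≤ volume B ^ (A / 2) * (ENNReal.ofReal (t ^ (-(N : ℝ))) ^ (A / 2 - 1) * K x) := by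
                gcongr
                · linarith
                · exact c2 x
            _ = _ := by
                rw [ENNReal.ofReal_rpow_of_pos (Real.rpow_pos_of_pos ht.1 _),
                  ← Real.rpow_mul ht.1.le, mul_assoc]
                congr 4; ring
      _ = (volume B ^ (A / 2) * ENNReal.ofReal (t ^ (-(N * (A / 2 - 1) : ℝ)))) * ∫⁻ x, K x :=
          lintegral_const_mul _ hKm
      _ ≤ (volume B ^ (A / 2) * ENNReal.ofReal (t ^ (-(N * (A / 2 - 1) : ℝ)))) * volume B := by
          gcongr
      _ = _ := by
          rw [ENNReal.rpow_add_of_nonneg _ _ (by linarith) (by linarith), ENNReal.rpow_one]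
          ring
  have hm2 : Measurable fun q : EuclideanSpace ℝ (Fin N) × ℝ =>
      ENNReal.ofReal (q.2 ^ (α * A)) * (∫⁻ y in B, g (q.1 + q.2 • y)) ^ A :=
    (by fun_prop : Measurable fun q : EuclideanSpace ℝ (Fin N) × ℝ =>
      ENNReal.ofReal (q.2 ^ (α * A))).mul (hH.pow_const _)
  calc _ ≤ ∫⁻ x, (∫⁻ t in Set.Ioo (0 : ℝ) 1, ENNReal.ofReal (t ^ (-α * A'))) ^ (A / A') *
      ∫⁻ t in Set.Ioo (0 : ℝ) 1, ENNReal.ofReal (t ^ (α * A)) *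
        (∫⁻ y in B, g (x + t • y)) ^ A := lintegral_mono step1
    _ = (∫⁻ t in Set.Ioo (0 : ℝ) 1, ENNReal.ofReal (t ^ (-α * A'))) ^ (A / A') *
      ∫⁻ x, ∫⁻ t in Set.Ioo (0 : ℝ) 1, ENNReal.ofReal (t ^ (α * A)) *
        (∫⁻ y in B, g (x + t • y)) ^ A := lintegral_const_mul _ hm2.lintegral_prod_right'
    _ ≤ _ := by
      gcongr
      rw [lintegral_lintegral_swap hm2.aemeasurable, ← lintegral_const_mul _ (by fun_prop)]
      refine setLIntegral_mono' measurableSet_Ioo fun t ht => ?_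
      rw [lintegral_const_mul _ ((hHt t).pow_const _)]
      calc _ ≤ ENNReal.ofReal (t ^ (α * A)) * (volume B ^ (A / 2 + 1) *
            ENNReal.ofReal (t ^ (-(N * (A / 2 - 1) : ℝ)))) := by gcongr; exact step2 t ht
        _ = volume B ^ (A / 2 + 1) * (ENNReal.ofReal (t ^ (α * A)) *
            ENNReal.ofReal (t ^ (-(N * (A / 2 - 1) : ℝ)))) := by ring
        _ = _ := by
            rw [← ENNReal.ofReal_mul (Real.rpow_nonneg ht.1.le _), ← Real.rpow_add ht.1]
            congr 3


lemma aux_pointwise {N : ℕ} {ρ : ℝ}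
    (hB : 2 ≤ volume (Metric.ball (0 : EuclideanSpace ℝ (Fin N)) ρ))
    {W : EuclideanSpace ℝ (Fin N) → ℝ} (hW : ContDiff ℝ 1 W)
    (hE : volume {x | 1 < W x} ≤ 1) (x : EuclideanSpace ℝ (Fin N)) :
    ENNReal.ofReal (W x) ≤ 1 + ENNReal.ofReal ρ * ∫⁻ t in Set.Ioo (0 : ℝ) 1,
      ∫⁻ y in Metric.ball (0 : EuclideanSpace ℝ (Fin N)) ρ, ‖fderiv ℝ W (x + t • y)‖ₑ := by
  have hc : Continuous (fderiv ℝ W) := hW.continuous_fderiv one_ne_zero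
  have hWc := hW.continuous
  have key : ∀ y ∈ Metric.ball (0 : EuclideanSpace ℝ (Fin N)) ρ, ENNReal.ofReal (W x) ≤
      ENNReal.ofReal (W (x + y)) +
        ENNReal.ofReal ρ * ∫⁻ t in Set.Ioo (0 : ℝ) 1, ‖fderiv ℝ W (x + t • y)‖ₑ := by
    intro y hy
    have hd : ∀ t : ℝ, HasDerivAt (fun t : ℝ => W (x + t • y)) (fderiv ℝ W (x + t • y) y) t := by
      intro t
      have h1 : HasDerivAt (fun t : ℝ => x + t • y) y t := by
        simpa using ((hasDerivAt_id t).smul_const y).const_add x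
      exact ((hW.differentiable one_ne_zero) (x + t • y)).hasFDerivAt.comp_hasDerivAt t h1
    have hci : Continuous fun t : ℝ => fderiv ℝ W (x + t • y) y := by fun_prop
    have hi := intervalIntegral.integral_eq_sub_of_hasDerivAt (a := 0) (b := 1)
      (fun t _ => hd t) (hci.intervalIntegrable _ _)
    simp only [one_smul, zero_smul, add_zero] at hi
    have h3 : ‖W (x + y) - W x‖ₑ ≤
        ENNReal.ofReal ρ * ∫⁻ t in Set.Ioo (0 : ℝ) 1, ‖fderiv ℝ W (x + t • y)‖ₑ := by
      rw [← hi, intervalIntegral.integral_of_le zero_le_one, integral_Ioc_eq_integral_Ioo,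
        ← lintegral_const_mul _ (by fun_prop)]
      refine (enorm_integral_le_lintegral_enorm _).trans (lintegral_mono fun t => ?_)
      rw [mul_comm]
      refine (ContinuousLinearMap.le_opENorm _ _).trans ?_
      gcongr
      rw [← ofReal_norm]
      exact ENNReal.ofReal_le_ofReal (by simpa using (mem_ball_zero_iff.1 hy).le)
    refine le_trans ?_ (add_le_add_right h3 _)
    rw [← ofReal_norm]
    refine le_trans (ENNReal.ofReal_le_ofReal ?_) ENNReal.ofReal_add_le
    rw [Real.norm_eq_abs]
    have := neg_abs_le (W (x + y) - W x)
    linarith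
  set B := Metric.ball (0 : EuclideanSpace ℝ (Fin N)) ρ with hBdef
  set F := B ∩ {y | W (x + y) ≤ 1} with hF
  have hFm : MeasurableSet F :=
    measurableSet_ball.inter (measurableSet_le (by fun_prop) measurable_const)
  have hvF : 1 ≤ volume F := by
    have h1 : volume {y | 1 < W (x + y)} ≤ 1 := by
      have : {y | 1 < W (x + y)} = (fun y => x + y) ⁻¹' {x | 1 < W x} := rfl
      rw [this, measure_preimage_add]; exact hE
    have h2 : volume B ≤ volume F + volume {y | 1 < W (x + y)} := by
      refine (measure_mono ?_).trans (measure_union_le _ _)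
      intro y hy
      by_cases h : W (x + y) ≤ 1
      · exact Or.inl ⟨hy, h⟩
      · exact Or.inr (not_le.1 h)
    have h3 : (1 : ENNReal) + 1 ≤ volume F + 1 := by
      rw [one_add_one_eq_two]
      exact (hB.trans h2).trans (by gcongr)
    exact (ENNReal.add_le_add_iff_right ENNReal.one_ne_top).1 h3
  have hgm : Measurable fun q : EuclideanSpace ℝ (Fin N) × ℝ => ‖fderiv ℝ W (x + q.2 • q.1)‖ₑ :=
    by fun_prop
  rw [add_comm, ← tsub_le_iff_right]
  calc ENNReal.ofReal (W x) - 1 ≤ (ENNReal.ofReal (W x) - 1) * volume F := by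
        simpa using mul_le_mul_right hvF (ENNReal.ofReal (W x) - 1)
    _ = ∫⁻ y in F, (ENNReal.ofReal (W x) - 1) := by simp
    _ ≤ ∫⁻ y in F, ENNReal.ofReal ρ * ∫⁻ t in Set.Ioo (0 : ℝ) 1, ‖fderiv ℝ W (x + t • y)‖ₑ := by
        refine setLIntegral_mono' hFm fun y hy => ?_
        rw [tsub_le_iff_right, add_comm]
        refine (key y hy.1).trans ?_
        gcongr
        simpa using ENNReal.ofReal_le_ofReal hy.2
    _ ≤ ∫⁻ y in B, ENNReal.ofReal ρ * ∫⁻ t in Set.Ioo (0 : ℝ) 1, ‖fderiv ℝ W (x + t • y)‖ₑ :=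
        lintegral_mono_set Set.inter_subset_left
    _ = ENNReal.ofReal ρ * ∫⁻ y in B, ∫⁻ t in Set.Ioo (0 : ℝ) 1, ‖fderiv ℝ W (x + t • y)‖ₑ :=
        lintegral_const_mul _ hgm.lintegral_prod_right'
    _ = _ := by rw [lintegral_lintegral_swap hgm.aemeasurable]

lemma aux_ball {N : ℕ} (hN : 1 ≤ N) :
    ∃ ρ : ℝ, 2 ≤ volume (Metric.ball (0 : EuclideanSpace ℝ (Fin N)) ρ) := by
  have : Nontrivial (EuclideanSpace ℝ (Fin N)) :=
    Module.nontrivial_of_finrank_pos (R := ℝ) (by simp; omega)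
  have h : Filter.Tendsto (fun n : ℕ => volume (Metric.ball (0 : EuclideanSpace ℝ (Fin N)) n))
      Filter.atTop (nhds (volume (⋃ n : ℕ, Metric.ball (0 : EuclideanSpace ℝ (Fin N)) n))) :=
    tendsto_measure_iUnion_atTop fun a b hab => Metric.ball_subset_ball (by exact_mod_cast hab)
  have hnc : NoncompactSpace (EuclideanSpace ℝ (Fin N)) := NormedSpace.noncompactSpace ℝ _
  rw [Metric.iUnion_ball_nat, measure_univ_of_isAddLeftInvariant] at h
  obtain ⟨n, hn⟩ := (h.eventually (lt_mem_nhds (ENNReal.ofNat_lt_top (n := 2)))).exists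
  exact ⟨n, hn.le⟩

lemma aux_choose {N : ℕ} (hN : 1 ≤ N) {σ S : ℝ} (hσN : -(N : ℝ) < σ) (hσu : σ < 0) (hS : 2 ≤ S)
    (hS2 : S * ((N : ℝ) - 2) < 2 * (N + σ)) :
    ∃ A : ℝ, S < A ∧ S * N < (N + σ) * A ∧ A * ((N : ℝ) - 2) < 2 * N := by
  have hN' : (1 : ℝ) ≤ N := by exact_mod_cast hN
  have hp : 0 < N + σ := by linarith
  have h0 : ∀ A : ℝ, S * N < (N + σ) * A → S < A := by
    intro A hA
    have : 0 < A := by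
      by_contra h
      nlinarith
    nlinarith
  rcases le_or_gt (N : ℝ) 2 with h | h
  · have hA : S * N < (N + σ) * (S * N / (N + σ) + 1) := by
      rw [mul_add, mul_div_cancel₀ _ hp.ne']; linarith
    refine ⟨S * N / (N + σ) + 1, h0 _ hA, hA, ?_⟩
    have : 0 < S * N / (N + σ) + 1 := by positivity
    nlinarith
  · have h1 : S * N / (N + σ) < 2 * N / (N - 2) := by
      rw [div_lt_div_iff₀ hp (by linarith)]; nlinarith
    obtain ⟨A, hA1, hA2⟩ := exists_between h1
    rw [div_lt_iff₀ hp] at hA1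
    rw [lt_div_iff₀ (by linarith)] at hA2
    exact ⟨A, h0 A (by linarith), by linarith, hA2⟩

lemma aux_normalized {N : ℕ} (hN : 1 ≤ N) {σ S : ℝ} (hσN : -(N : ℝ) < σ) (hσu : σ < 0)
    (hS : 2 ≤ S) (hS2 : S * ((N : ℝ) - 2) < 2 * (N + σ)) :
    ∃ C : ENNReal, C < ⊤ ∧ ∀ (q s : ℝ) (W : EuclideanSpace ℝ (Fin N) → ℝ), 0 < q → q ≤ s → s ≤ S →
      (∀ x, 0 ≤ W x) → ContDiff ℝ 1 W → ∫⁻ x, ENNReal.ofReal (W x ^ q) ≤ 1 →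
      ∫⁻ x, ‖fderiv ℝ W x‖ₑ ^ (2 : ℝ) ≤ 1 →
      ∫⁻ x, ENNReal.ofReal (‖x‖ ^ σ * W x ^ s) ≤ C := by
  obtain ⟨A, hSA, hA1, hA2⟩ := aux_choose hN hσN hσu hS hS2
  obtain ⟨ρ, hρ⟩ := aux_ball hN
  set B := Metric.ball (0 : EuclideanSpace ℝ (Fin N)) ρ with hB
  set B1 := Metric.ball (0 : EuclideanSpace ℝ (Fin N)) 1 with hB1
  obtain ⟨CT, hCT, hT⟩ := aux_T (A := A) (by linarith) hA2 B measure_ball_lt_top.ne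
  have hA0 : 0 < A := by linarith
  set τ : ℝ := A / (A - S) with hτ
  have hconj : (A / S).HolderConjugate τ := by
    have := Real.HolderConjugate.conjExponent (p := A / S) (by rw [lt_div_iff₀] <;> linarith)
    convert this using 1
    rw [hτ, Real.conjExponent]
    have : A - S ≠ 0 := by linarith
    have : S ≠ 0 := by linarith
    field_simp
  have hστ : -(N : ℝ) < σ * τ := by
    rw [hτ, ← mul_div_assoc, lt_div_iff₀ (by linarith)]
    nlinarith
  set I1 := ∫⁻ x in B1, ENNReal.ofReal (‖x‖ ^ σ)
  set I2 := ∫⁻ x in B1, ENNReal.ofReal (‖x‖ ^ (σ * τ))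
  refine ⟨I1 + I2 + 1 + 2 ^ (A - 1) * (1 + ENNReal.ofReal ρ ^ A * CT), ?_, ?_⟩
  · have h1 : I1 < ⊤ := aux_norm_pow hN hσN
    have h2 : I2 < ⊤ := aux_norm_pow hN hστ
    have h3 : (2 : ENNReal) ^ (A - 1) < ⊤ :=
      ENNReal.rpow_lt_top_of_nonneg (by linarith) (by simp)
    have h4 : ENNReal.ofReal ρ ^ A < ⊤ := ENNReal.rpow_lt_top_of_nonneg hA0.le (by simp)
    have h5 := ENNReal.mul_lt_top h4 hCT
    have h6 : 1 + ENNReal.ofReal ρ ^ A * CT < ⊤ := ENNReal.add_lt_top.2 ⟨by simp, h5⟩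
    have h7 := ENNReal.mul_lt_top h3 h6
    simp only [ENNReal.add_lt_top]
    exact ⟨⟨⟨h1, h2⟩, by simp⟩, h7⟩
  intro q s W hq hqs hsS hW0 hW hWq hWg
  have hWc := hW.continuous
  have hc : Continuous (fderiv ℝ W) := hW.continuous_fderiv one_ne_zero
  have hE : volume {x | 1 < W x} ≤ 1 := by
    refine le_trans ?_ hWq
    rw [← lintegral_indicator_one (measurableSet_lt measurable_const hWc.measurable)]
    refine lintegral_mono fun x => ?_
    by_cases h : 1 < W x
    · simp only [Set.indicator, Set.mem_ofPred_eq, h, if_true, Pi.one_apply]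
      simpa using ENNReal.ofReal_le_ofReal (Real.one_le_rpow h.le hq.le)
    · simp [Set.indicator, h]
  set T : EuclideanSpace ℝ (Fin N) → ENNReal := fun x =>
    ∫⁻ t in Set.Ioo (0 : ℝ) 1, ∫⁻ y in B, ‖fderiv ℝ W (x + t • y)‖ₑ with hTdef
  have hgm : Measurable fun q : (EuclideanSpace ℝ (Fin N) × ℝ) × EuclideanSpace ℝ (Fin N) =>
      ‖fderiv ℝ W (q.1.1 + q.1.2 • q.2)‖ₑ := by fun_prop
  have hTm : Measurable T := (hgm.lintegral_prod_right').lintegral_prod_right'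
  have hTA : ∫⁻ x, T x ^ A ≤ CT := hT (fun x => ‖fderiv ℝ W x‖ₑ) (by fun_prop) hWg
  have hpt : ∀ x, ENNReal.ofReal (‖x‖ ^ σ * W x ^ s) ≤
      B1.indicator (fun x => ENNReal.ofReal (‖x‖ ^ σ)) x +
      B1.indicator (fun x => ENNReal.ofReal (‖x‖ ^ (σ * τ))) x + ENNReal.ofReal (W x ^ q) +
      2 ^ (A - 1) * (ENNReal.ofReal (W x ^ q) + ENNReal.ofReal ρ ^ A * T x ^ A) := by
    intro x
    have hx0 := norm_nonneg x
    have hxσ : 0 ≤ ‖x‖ ^ σ := Real.rpow_nonneg hx0 _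
    have hout : x ∉ B1 → ‖x‖ ^ σ ≤ 1 := by
      intro h
      have : 1 ≤ ‖x‖ := by simpa [hB1] using h
      exact Real.rpow_le_one_of_one_le_of_nonpos this hσu.le
    rcases le_or_gt (W x) 1 with h | h
    · by_cases hx : x ∈ B1
      · have : ‖x‖ ^ σ * W x ^ s ≤ ‖x‖ ^ σ :=
          mul_le_of_le_one_right hxσ (Real.rpow_le_one (hW0 x) h (by linarith))
        simp only [Set.indicator, hx, if_true]
        rw [add_assoc, add_assoc]
        exact (ENNReal.ofReal_le_ofReal this).trans le_self_add
      · have : ‖x‖ ^ σ * W x ^ s ≤ W x ^ q := by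
          calc ‖x‖ ^ σ * W x ^ s ≤ W x ^ s :=
                mul_le_of_le_one_left (Real.rpow_nonneg (hW0 x) _) (hout hx)
            _ ≤ W x ^ q := by
                rcases (hW0 x).eq_or_lt with h0 | h0
                · rw [← h0, Real.zero_rpow (by linarith), Real.zero_rpow (by linarith)]
                · exact Real.rpow_le_rpow_of_exponent_ge h0 h hqs
        refine (ENNReal.ofReal_le_ofReal this).trans ?_
        exact le_add_self.trans le_self_add
    · have hWA : ENNReal.ofReal (W x ^ A) ≤
          2 ^ (A - 1) * (ENNReal.ofReal (W x ^ q) + ENNReal.ofReal ρ ^ A * T x ^ A) := by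
        rw [← ENNReal.ofReal_rpow_of_nonneg (hW0 x) hA0.le]
        calc ENNReal.ofReal (W x) ^ A ≤ (1 + ENNReal.ofReal ρ * T x) ^ A :=
              ENNReal.rpow_le_rpow (aux_pointwise hρ hW hE x) hA0.le
          _ ≤ 2 ^ (A - 1) * (1 ^ A + (ENNReal.ofReal ρ * T x) ^ A) :=
              ENNReal.rpow_add_le_mul_rpow_add_rpow _ _ (by linarith)
          _ ≤ _ := by
              rw [ENNReal.one_rpow, ENNReal.mul_rpow_of_nonneg _ _ hA0.le]
              gcongr
              simpa using ENNReal.ofReal_le_ofReal (Real.one_le_rpow h.le hq.le)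
      by_cases hx : x ∈ B1
      · have hy : ‖x‖ ^ σ * W x ^ s ≤ ‖x‖ ^ (σ * τ) + W x ^ A := by
          have h1 := Real.young_inequality_of_nonneg (Real.rpow_nonneg (hW0 x) S) hxσ hconj
          rw [← Real.rpow_mul (hW0 x), ← Real.rpow_mul hx0,
            mul_div_cancel₀ A (by linarith : S ≠ 0)] at h1
          have h2 : W x ^ A / (A / S) ≤ W x ^ A :=
            div_le_self (Real.rpow_nonneg (hW0 x) _) hconj.lt.le
          have h3 : ‖x‖ ^ (σ * τ) / τ ≤ ‖x‖ ^ (σ * τ) :=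
            div_le_self (Real.rpow_nonneg hx0 _) hconj.symm.lt.le
          have h4 : ‖x‖ ^ σ * W x ^ s ≤ ‖x‖ ^ σ * W x ^ S :=
            mul_le_mul_of_nonneg_left (Real.rpow_le_rpow_of_exponent_le h.le hsS) hxσ
          linarith
        refine (ENNReal.ofReal_le_ofReal hy).trans (ENNReal.ofReal_add_le.trans ?_)
        simp only [Set.indicator, hx, if_true]
        exact add_le_add (le_add_self.trans le_self_add) hWA
      · have : ‖x‖ ^ σ * W x ^ s ≤ W x ^ A := by
          calc ‖x‖ ^ σ * W x ^ s ≤ W x ^ s :=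
                mul_le_of_le_one_left (Real.rpow_nonneg (hW0 x) _) (hout hx)
            _ ≤ W x ^ A := Real.rpow_le_rpow_of_exponent_le h.le (by linarith)
        exact (ENNReal.ofReal_le_ofReal this).trans (hWA.trans le_add_self)
  have m1 : Measurable (B1.indicator (fun x => ENNReal.ofReal (‖x‖ ^ σ))) :=
    Measurable.indicator (by fun_prop) measurableSet_ball
  have m2 : Measurable (B1.indicator (fun x => ENNReal.ofReal (‖x‖ ^ (σ * τ)))) :=
    Measurable.indicator (by fun_prop) measurableSet_ball
  have m3 : Measurable fun x => ENNReal.ofReal (W x ^ q) := by fun_prop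
  have m12 : Measurable fun x => B1.indicator (fun x => ENNReal.ofReal (‖x‖ ^ σ)) x +
      B1.indicator (fun x => ENNReal.ofReal (‖x‖ ^ (σ * τ))) x := m1.add m2
  have m123 : Measurable fun x => B1.indicator (fun x => ENNReal.ofReal (‖x‖ ^ σ)) x +
      B1.indicator (fun x => ENNReal.ofReal (‖x‖ ^ (σ * τ))) x + ENNReal.ofReal (W x ^ q) :=
    m12.add m3
  refine (lintegral_mono hpt).trans ?_
  rw [lintegral_add_left m123, lintegral_add_left m12, lintegral_add_left m1,
    lintegral_indicator measurableSet_ball, lintegral_indicator measurableSet_ball,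
    lintegral_const_mul _ (by fun_prop), lintegral_add_left m3,
    lintegral_const_mul _ (by fun_prop)]
  gcongr

lemma aux_scaled {N : ℕ} {σ q s g h : ℝ} {C : ENNReal}
    (hC : ∀ W : EuclideanSpace ℝ (Fin N) → ℝ,
      (∀ x, 0 ≤ W x) → ContDiff ℝ 1 W → ∫⁻ x, ENNReal.ofReal (W x ^ q) ≤ 1 →
      ∫⁻ x, ‖fderiv ℝ W x‖ₑ ^ (2 : ℝ) ≤ 1 →
      ∫⁻ x, ENNReal.ofReal (‖x‖ ^ σ * W x ^ s) ≤ C)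
    {D : ℝ} (hD : D = 2 * N - q * ((N : ℝ) - 2)) (hD0 : 0 < D)
    (W : EuclideanSpace ℝ (Fin N) → ℝ) (hW0 : ∀ x, 0 ≤ W x) (hW : ContDiff ℝ 1 W)
    (hWq : ∫⁻ x, ENNReal.ofReal (W x ^ q) ≤ ENNReal.ofReal (Real.exp h))
    (hWg : ∫⁻ x, ‖fderiv ℝ W x‖ₑ ^ (2 : ℝ) ≤ ENNReal.ofReal (Real.exp g)) :
    ∫⁻ x, ENNReal.ofReal (‖x‖ ^ σ * W x ^ s) ≤ C * ENNReal.ofReal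
      (Real.exp ((s * N - q * (σ + N)) / D * g + (2 * (σ + N) - s * ((N : ℝ) - 2)) / D * h)) := by
  set b : ℝ := (2 * h - q * g) / D with hb
  set a : ℝ := (-(N * g) + ((N : ℝ) - 2) * h) / D with ha
  have e1 : 2 * (a + b) - N * b = -g := by
    rw [ha, hb]; field_simp; rw [hD]; ring
  have e2 : q * a - N * b = -h := by
    rw [ha, hb]; field_simp; rw [hD]; ring
  have e3 : (s * N - q * (σ + N)) / D * g + (2 * (σ + N) - s * ((N : ℝ) - 2)) / D * h
      = -(s * a - σ * b - N * b) := by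
    rw [ha, hb]; field_simp; ring
  rw [e3]
  have hl : 0 < Real.exp b := Real.exp_pos b
  have hexp : ∀ u v : ℝ, Real.exp u ^ v = Real.exp (v * u) := fun u v => by
    rw [← Real.exp_mul, mul_comm]
  have hdil : ∀ (c : ℝ) (f : EuclideanSpace ℝ (Fin N) → ENNReal),
      ∫⁻ x, ENNReal.ofReal (Real.exp c) * f (Real.exp b • x) =
        ENNReal.ofReal (Real.exp (c - N * b)) * ∫⁻ x, f x := by
    intro c f
    rw [lintegral_const_mul' _ _ ENNReal.ofReal_ne_top, aux_lintegral_smul f hl, ← mul_assoc,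
      ← ENNReal.ofReal_mul (Real.exp_pos _).le, hexp, ← Real.exp_add]
    congr 3; ring
  have hone : ∀ u v : ℝ, u = -v → ENNReal.ofReal (Real.exp u) * ENNReal.ofReal (Real.exp v) = 1 := by
    intro u v huv
    rw [← ENNReal.ofReal_mul (Real.exp_pos _).le, ← Real.exp_add, huv]
    simp
  have hV := hC (fun x => Real.exp a * W (Real.exp b • x))
    (fun x => mul_nonneg (Real.exp_pos _).le (hW0 _)) (by fun_prop) ?_ ?_
  · have : ∀ x, ENNReal.ofReal (‖x‖ ^ σ * (Real.exp a * W (Real.exp b • x)) ^ s) =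
        ENNReal.ofReal (Real.exp (s * a - σ * b)) *
          (fun z => ENNReal.ofReal (‖z‖ ^ σ * W z ^ s)) (Real.exp b • x) := by
      intro x
      simp only
      rw [← ENNReal.ofReal_mul (Real.exp_pos _).le]
      congr 1
      rw [Real.mul_rpow (Real.exp_pos _).le (hW0 _), norm_smul, Real.norm_of_nonneg hl.le,
        Real.mul_rpow hl.le (norm_nonneg _), hexp, hexp, Real.exp_sub]
      field_simp
    rw [(lintegral_congr this).trans (hdil _ (fun z => ENNReal.ofReal (‖z‖ ^ σ * W z ^ s)))] at hV
    calc _ = (ENNReal.ofReal (Real.exp (s * a - σ * b - N * b)) *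
          ENNReal.ofReal (Real.exp (-(s * a - σ * b - N * b)))) *
          ∫⁻ x, ENNReal.ofReal (‖x‖ ^ σ * W x ^ s) := by
          rw [hone _ _ (by ring), one_mul]
      _ = (ENNReal.ofReal (Real.exp (s * a - σ * b - N * b)) *
          ∫⁻ x, ENNReal.ofReal (‖x‖ ^ σ * W x ^ s)) *
          ENNReal.ofReal (Real.exp (-(s * a - σ * b - N * b))) := by ring
      _ ≤ _ := by gcongr
  · have : ∀ x, ENNReal.ofReal ((Real.exp a * W (Real.exp b • x)) ^ q) =
        ENNReal.ofReal (Real.exp (q * a)) *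
          (fun z => ENNReal.ofReal (W z ^ q)) (Real.exp b • x) := by
      intro x
      simp only
      rw [← ENNReal.ofReal_mul (Real.exp_pos _).le,
        Real.mul_rpow (Real.exp_pos _).le (hW0 _), hexp]
    rw [(lintegral_congr this).trans (hdil _ (fun z => ENNReal.ofReal (W z ^ q))), e2]
    calc _ ≤ ENNReal.ofReal (Real.exp (-h)) * ENNReal.ofReal (Real.exp h) := by gcongr
      _ = 1 := hone _ _ rfl
  · have : ∀ x, ‖fderiv ℝ (fun x => Real.exp a * W (Real.exp b • x)) x‖ₑ ^ (2 : ℝ) =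
        ENNReal.ofReal (Real.exp (2 * (a + b))) *
          (fun z => ‖fderiv ℝ W z‖ₑ ^ (2 : ℝ)) (Real.exp b • x) := by
      intro x
      have hd : DifferentiableAt ℝ (fun x => W (Real.exp b • x)) x :=
        ((hW.differentiable one_ne_zero).comp (by fun_prop :
          Differentiable ℝ fun x : EuclideanSpace ℝ (Fin N) => Real.exp b • x)) x
      simp only
      rw [fderiv_const_mul hd, fderiv_comp_smul, enorm_smul, enorm_smul,
        Real.enorm_of_nonneg hl.le, Real.enorm_of_nonneg (Real.exp_pos a).le, ← mul_assoc,
        ← ENNReal.ofReal_mul (Real.exp_pos _).le, ← Real.exp_add,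
        ENNReal.mul_rpow_of_nonneg _ _ (by norm_num),
        ENNReal.ofReal_rpow_of_pos (Real.exp_pos _), hexp]
    rw [(lintegral_congr this).trans (hdil _ (fun z => ‖fderiv ℝ W z‖ₑ ^ (2 : ℝ))), e1]
    calc _ ≤ ENNReal.ofReal (Real.exp (-g)) * ENNReal.ofReal (Real.exp g) := by gcongr
      _ = 1 := hone _ _ rfl


/-- Proposition 3.2: weighted interpolation inequality for the source term. -/
theorem weighted_source_estimate
    (N : ℕ) (hN : 1 ≤ N) (m p σ : ℝ) (hm : 1 < m) (hp : 1 < p)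
    (hσl : max (-2) (-(N : ℝ)) < σ) (hσu : σ < 0)
    (rbar : ℝ) (hrbar : max ((N : ℝ) * (p - m) / (σ + 2) - 1) 0 < rbar) :
    ∃ Λ : ℝ, 1 ≤ Λ ∧
      ∀ r₁ r : ℝ, max ((N : ℝ) * (p - m) / (σ + 2) - 1) 0 ≤ r₁ → r₁ ≤ r → r ≤ rbar →
        ∀ w : EuclideanSpace ℝ (Fin N) → ℝ, (∀ x, 0 ≤ w x) →
          (∫⁻ x, ENNReal.ofReal (w x ^ (r₁ + 1))) < ⊤ →
          ContDiff ℝ 1 (fun x => w x ^ ((m + r) / 2)) →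
          (∫⁻ x, ENNReal.ofReal (‖gradient (fun y => w y ^ ((m + r) / 2)) x‖ ^ 2)) < ⊤ →
          (∫⁻ x, ENNReal.ofReal (‖x‖ ^ σ * w x ^ (p + r))) ≤
            ENNReal.ofReal Λ
              * (∫⁻ x, ENNReal.ofReal (‖gradient (fun y => w y ^ ((m + r) / 2)) x‖ ^ 2)) ^
                  (((N : ℝ) * (p - 1) - σ * (r₁ + 1) + N * (r - r₁)) /
                    ((N : ℝ) * (m - 1) + 2 * (r₁ + 1) + N * (r - r₁)))
              * (∫⁻ x, ENNReal.ofReal (w x ^ (r₁ + 1))) ^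
                  ((((N : ℝ) - 2) * (m - p) + (σ + 2) * (m + r)) /
                    ((N : ℝ) * (m - 1) + 2 * (r₁ + 1) + N * (r - r₁))) := by
  have hN' : (1 : ℝ) ≤ N := by exact_mod_cast hN
  have hσ2 : -2 < σ := (le_max_left _ _).trans_lt hσl
  have hσN : -(N : ℝ) < σ := (le_max_right _ _).trans_lt hσl
  set c : ℝ := max ((N : ℝ) * (p - m) / (σ + 2) - 1) 0 with hcdef
  have hc0 : 0 ≤ c := le_max_right _ _
  have hc1 : (N : ℝ) * (p - m) ≤ (c + 1) * (σ + 2) := by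
    have : (N : ℝ) * (p - m) / (σ + 2) - 1 ≤ c := le_max_left _ _
    rw [← div_le_iff₀ (by linarith)]; linarith
  have key : ((N : ℝ) - 2) * (p - m) < (σ + 2) * (m + c) := by
    have hmc : (c + 1) * (σ + 2) < (σ + 2) * (m + c) := by nlinarith
    rcases le_or_gt p m with hpm | hpm
    · rcases hN.eq_or_lt with h1 | h1
      · have : (N : ℝ) = 1 := by exact_mod_cast h1.symm
        rw [this] at hσN ⊢
        nlinarith
      · have : (2 : ℝ) ≤ N := by exact_mod_cast h1
        nlinarith [mul_nonneg (sub_nonneg.2 this) (sub_nonneg.2 hpm),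
          mul_pos (by linarith : 0 < σ + 2) (by linarith : 0 < m + c)]
    · nlinarith
  have hS2 : max 2 (2 * (p + c) / (m + c)) * ((N : ℝ) - 2) < 2 * (N + σ) := by
    rcases max_choice 2 (2 * (p + c) / (m + c)) with h | h <;> rw [h]
    · linarith
    · rw [div_mul_eq_mul_div, div_lt_iff₀ (by linarith)]
      nlinarith
  obtain ⟨C, hC, hmain⟩ := aux_normalized hN hσN hσu (le_max_left 2 (2 * (p + c) / (m + c))) hS2
  refine ⟨max 1 C.toReal, le_max_left _ _, ?_⟩
  intro r₁ r hr₁ hr hrr w hw hM hW hG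
  have hmr : 0 < m + r := by linarith
  set W : EuclideanSpace ℝ (Fin N) → ℝ := fun x => w x ^ ((m + r) / 2) with hWdef
  have hW0 : ∀ x, 0 ≤ W x := fun x => Real.rpow_nonneg (hw x) _
  set q : ℝ := 2 * (r₁ + 1) / (m + r) with hq
  set s : ℝ := 2 * (p + r) / (m + r) with hs
  have hq0 : 0 < q := div_pos (by linarith) hmr
  have hqs : q ≤ s := by
    rw [hq, hs]; exact div_le_div_of_nonneg_right (by linarith) hmr.le
  have hsS : s ≤ max 2 (2 * (p + c) / (m + c)) := by
    rcases le_or_gt p m with hpm | hpm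
    · refine le_trans ?_ (le_max_left _ _)
      rw [hs, div_le_iff₀ hmr]; linarith
    · refine le_trans ?_ (le_max_right _ _)
      rw [hs, div_le_div_iff₀ hmr (by linarith)]
      nlinarith [mul_nonneg (sub_nonneg.2 hpm.le) (sub_nonneg.2 (hr₁.trans hr))]
  have hq2 : q < 2 := by rw [hq, div_lt_iff₀ hmr]; linarith
  have hD0 : 0 < 2 * N - q * ((N : ℝ) - 2) := by nlinarith
  have hWq : ∀ x, W x ^ q = w x ^ (r₁ + 1) := fun x => by
    rw [hWdef, hq]
    simp only
    rw [← Real.rpow_mul (hw x)]; congr 1; field_simp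
  have hWs : ∀ x, W x ^ s = w x ^ (p + r) := fun x => by
    rw [hWdef, hs]
    simp only
    rw [← Real.rpow_mul (hw x)]; congr 1; field_simp
  have hgrad : ∀ x, ENNReal.ofReal (‖gradient W x‖ ^ 2) = ‖fderiv ℝ W x‖ₑ ^ (2 : ℝ) := fun x => by
    rw [gradient, LinearIsometryEquiv.norm_map, ENNReal.ofReal_pow (norm_nonneg _), ofReal_norm]
    norm_cast
  have eω : ((N : ℝ) * (p - 1) - σ * (r₁ + 1) + N * (r - r₁)) /
      ((N : ℝ) * (m - 1) + 2 * (r₁ + 1) + N * (r - r₁)) =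
      (s * N - q * (σ + N)) / (2 * N - q * ((N : ℝ) - 2)) := by
    have h1 : s * N - q * (σ + N) =
        ((N : ℝ) * (p - 1) - σ * (r₁ + 1) + N * (r - r₁)) * (2 / (m + r)) := by
      rw [hq, hs]; field_simp; ring
    have h2 : 2 * N - q * ((N : ℝ) - 2) =
        ((N : ℝ) * (m - 1) + 2 * (r₁ + 1) + N * (r - r₁)) * (2 / (m + r)) := by
      rw [hq]; field_simp; ring
    rw [h1, h2, mul_div_mul_right _ _ (by positivity)]
  have eμ : (((N : ℝ) - 2) * (m - p) + (σ + 2) * (m + r)) /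
      ((N : ℝ) * (m - 1) + 2 * (r₁ + 1) + N * (r - r₁)) =
      (2 * (σ + N) - s * ((N : ℝ) - 2)) / (2 * N - q * ((N : ℝ) - 2)) := by
    have h1 : 2 * (σ + N) - s * ((N : ℝ) - 2) =
        (((N : ℝ) - 2) * (m - p) + (σ + 2) * (m + r)) * (2 / (m + r)) := by
      rw [hs]; field_simp; ring
    have h2 : 2 * N - q * ((N : ℝ) - 2) =
        ((N : ℝ) * (m - 1) + 2 * (r₁ + 1) + N * (r - r₁)) * (2 / (m + r)) := by
      rw [hq]; field_simp; ring
    rw [h1, h2, mul_div_mul_right _ _ (by positivity)]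
  have hω0 : 0 ≤ ((N : ℝ) * (p - 1) - σ * (r₁ + 1) + N * (r - r₁)) /
      ((N : ℝ) * (m - 1) + 2 * (r₁ + 1) + N * (r - r₁)) := by
    have h1 : 0 ≤ (N : ℝ) * (p - 1) := mul_nonneg (by linarith) (by linarith)
    have h2 : 0 ≤ (N : ℝ) * (r - r₁) := mul_nonneg (by linarith) (by linarith)
    have h3 : 0 ≤ -σ * (r₁ + 1) := mul_nonneg (by linarith) (by linarith)
    have h4 : 0 ≤ (N : ℝ) * (m - 1) := mul_nonneg (by linarith) (by linarith)
    exact div_nonneg (by linarith) (by linarith)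
  have hμ0 : 0 ≤ (((N : ℝ) - 2) * (m - p) + (σ + 2) * (m + r)) /
      ((N : ℝ) * (m - 1) + 2 * (r₁ + 1) + N * (r - r₁)) := by
    have h2 : 0 ≤ (N : ℝ) * (r - r₁) := mul_nonneg (by linarith) (by linarith)
    have h4 : 0 ≤ (N : ℝ) * (m - 1) := mul_nonneg (by linarith) (by linarith)
    refine div_nonneg ?_ (by linarith)
    have : (σ + 2) * (m + c) ≤ (σ + 2) * (m + r) :=
      mul_le_mul_of_nonneg_left (by linarith) (by linarith)
    linarith
  set ω := ((N : ℝ) * (p - 1) - σ * (r₁ + 1) + N * (r - r₁)) /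
      ((N : ℝ) * (m - 1) + 2 * (r₁ + 1) + N * (r - r₁)) with hωdef
  set μ := (((N : ℝ) - 2) * (m - p) + (σ + 2) * (m + r)) /
      ((N : ℝ) * (m - 1) + 2 * (r₁ + 1) + N * (r - r₁)) with hμdef
  set M := ∫⁻ x, ENNReal.ofReal (w x ^ (r₁ + 1)) with hMdef
  set G := ∫⁻ x, ENNReal.ofReal (‖gradient W x‖ ^ 2) with hGdef
  have hI : ∀ ε : ℝ, 0 < ε → ∫⁻ x, ENNReal.ofReal (‖x‖ ^ σ * w x ^ (p + r)) ≤
      C * ENNReal.ofReal ((G.toReal + ε) ^ ω * (M.toReal + ε) ^ μ) := by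
    intro ε hε
    have hGp : 0 < G.toReal + ε := add_pos_of_nonneg_of_pos ENNReal.toReal_nonneg hε
    have hMp : 0 < M.toReal + ε := add_pos_of_nonneg_of_pos ENNReal.toReal_nonneg hε
    have := aux_scaled (g := Real.log (G.toReal + ε)) (h := Real.log (M.toReal + ε))
      (fun V => hmain q s V hq0 hqs hsS) rfl hD0 W hW0 hW
      (by
        simp only [hWq]
        rw [Real.exp_log hMp, ← hMdef]
        exact (ENNReal.ofReal_toReal hM.ne).ge.trans (ENNReal.ofReal_le_ofReal (by linarith)))
      (by
        simp only [← hgrad]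
        rw [Real.exp_log hGp, ← hGdef]
        exact (ENNReal.ofReal_toReal hG.ne).ge.trans (ENNReal.ofReal_le_ofReal (by linarith)))
    simp only [hWs] at this
    rw [← eω, ← eμ, Real.exp_add] at this
    rwa [Real.rpow_def_of_pos hGp, Real.rpow_def_of_pos hMp, mul_comm (Real.log _) ω,
      mul_comm (Real.log _) μ]
  have hlim : Filter.Tendsto (fun ε : ℝ =>
      C * ENNReal.ofReal ((G.toReal + ε) ^ ω * (M.toReal + ε) ^ μ)) (nhdsWithin 0 (Set.Ioi 0))
      (nhds (C * ENNReal.ofReal ((G.toReal + 0) ^ ω * (M.toReal + 0) ^ μ))) := by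
    refine ENNReal.Tendsto.const_mul (ENNReal.tendsto_ofReal ?_) (Or.inr hC.ne)
    have : Continuous fun ε : ℝ => (G.toReal + ε) ^ ω * (M.toReal + ε) ^ μ :=
      ((continuous_const.add continuous_id).rpow_const fun _ => Or.inr hω0).mul
        ((continuous_const.add continuous_id).rpow_const fun _ => Or.inr hμ0)
    exact (this.tendsto 0).mono_left nhdsWithin_le_nhds
  have hfin := ge_of_tendsto hlim (eventually_nhdsWithin_of_forall fun ε hε => hI ε hε)
  refine hfin.trans ?_
  rw [add_zero, add_zero, ENNReal.ofReal_mul (Real.rpow_nonneg ENNReal.toReal_nonneg _),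
    ← ENNReal.ofReal_rpow_of_nonneg ENNReal.toReal_nonneg hω0,
    ← ENNReal.ofReal_rpow_of_nonneg ENNReal.toReal_nonneg hμ0,
    ENNReal.ofReal_toReal hM.ne, ENNReal.ofReal_toReal hG.ne, ← mul_assoc]
  gcongr
  calc C = ENNReal.ofReal C.toReal := (ENNReal.ofReal_toReal hC.ne).symm
    _ ≤ _ := ENNReal.ofReal_le_ofReal (le_max_right _ _)
end

section
/- Assume p > p_F and let r̄ > r_0. Then there exists a constant Λ ≥ 1, depending only on N, m, p, σ and r̄, such that for every r ∈ [r_0, r̄] the following holds: for every nonnegative function w : ℝᴺ → ℝ such that ∫_{ℝᴺ} w(x)^{r_0+1} dx < ∞ and such that W := w^{(m+r)/2} is continuously differentiable on ℝᴺ with ∫_{ℝᴺ} ‖∇W(x)‖² dx < ∞, one has ∫_{ℝᴺ} |x|^σ w(x)^{p+r} dx ≤ Λ · (∫_{ℝᴺ} ‖∇W(x)‖² dx) · (∫_{ℝᴺ} w(x)^{r_0+1} dx)^{(σ+2)/N}. -/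
open MeasureTheory
open scoped ENNReal

lemma wse_ball_int (N : ℕ) (hN : 1 ≤ N) (γ : ℝ) (hγN : γ < N) :
    ∃ C : ℝ≥0∞, C ≠ ⊤ ∧ ∀ R : ℝ, 0 < R →
      ∫⁻ x in Metric.ball (0 : EuclideanSpace ℝ (Fin N)) R, ENNReal.ofReal (‖x‖ ^ (-γ)) ≤
        C * ENNReal.ofReal (R ^ (N - γ)) := by
  have : Nonempty (Fin N) := ⟨⟨0, hN⟩⟩
  refine ⟨∫⁻ x in Metric.ball (0 : EuclideanSpace ℝ (Fin N)) 1, ENNReal.ofReal (‖x‖ ^ (-γ)), ?_, ?_⟩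
  · have h : IntegrableOn (fun x : EuclideanSpace ℝ (Fin N) => (fun y : ℝ => y ^ (-γ)) ‖x‖)
        (Metric.ball 0 1) := by
      rw [integrableOn_fun_norm_addHaar volume (f := fun y : ℝ => y ^ (-γ))]
      have h1 : IntegrableOn (fun y : ℝ => y ^ ((N : ℝ) - 1 - γ)) (Set.Ioo 0 1) := by
        rw [intervalIntegral.integrableOn_Ioo_rpow_iff zero_lt_one]
        linarith
      refine h1.congr_fun (fun y hy => ?_) measurableSet_Ioo
      have hy0 : 0 < y := hy.1
      simp only [finrank_euclideanSpace, Fintype.card_fin, smul_eq_mul]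
      rw [← Real.rpow_natCast, ← Real.rpow_add hy0]
      congr 1
      rw [Nat.cast_sub hN]; push_cast; ring
    have h2 := h.2
    have := (hasFiniteIntegral_iff_ofReal (Filter.Eventually.of_forall fun x => by positivity)).1 h2
    exact this.ne
  · intro R hR
    have hR0 : R ≠ 0 := hR.ne'
    set g : EuclideanSpace ℝ (Fin N) → ℝ≥0∞ :=
      (Metric.ball (0 : EuclideanSpace ℝ (Fin N)) R).indicator
        (fun x => ENNReal.ofReal (‖x‖ ^ (-γ))) with hg
    have hgm : Measurable g := by
      apply Measurable.indicator _ measurableSet_ball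
      fun_prop
    have h1 : ∫⁻ x, g (R • x) = ENNReal.ofReal |(R ^ N)⁻¹| * ∫⁻ x, g x := by
      rw [← lintegral_map (f := g) (g := fun x => R • x) hgm (by fun_prop),
        Measure.map_addHaar_smul volume hR0, lintegral_smul_measure]
      simp
    have h2 : ∀ x, g (R • x) = ENNReal.ofReal (R ^ (-γ)) *
        (Metric.ball (0 : EuclideanSpace ℝ (Fin N)) 1).indicator
        (fun x => ENNReal.ofReal (‖x‖ ^ (-γ))) x := by
      intro x
      have hm : R • x ∈ Metric.ball (0 : EuclideanSpace ℝ (Fin N)) R ↔ x ∈ Metric.ball (0 : EuclideanSpace ℝ (Fin N)) 1 := by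
        simp only [mem_ball_zero_iff, norm_smul, Real.norm_eq_abs, abs_of_pos hR]
        constructor
        · intro h; by_contra h'; push Not at h'; nlinarith
        · intro h; nlinarith
      by_cases hx : x ∈ Metric.ball (0 : EuclideanSpace ℝ (Fin N)) 1
      · rw [hg, Set.indicator_of_mem (hm.2 hx), Set.indicator_of_mem hx, norm_smul,
          Real.norm_eq_abs, abs_of_pos hR, Real.mul_rpow hR.le (norm_nonneg _),
          ENNReal.ofReal_mul (by positivity)]
      · rw [hg, Set.indicator_of_notMem (fun h => hx (hm.1 h)), Set.indicator_of_notMem hx, mul_zero]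
    simp_rw [h2] at h1
    rw [lintegral_const_mul' _ _ ENNReal.ofReal_ne_top, lintegral_indicator measurableSet_ball,
      hg, lintegral_indicator measurableSet_ball, abs_of_pos (by positivity)] at h1
    have h3 : ENNReal.ofReal (R ^ N) * ENNReal.ofReal ((R ^ N)⁻¹) = 1 := by
      rw [← ENNReal.ofReal_mul (by positivity), mul_inv_cancel₀ (by positivity), ENNReal.ofReal_one]
    apply le_of_eq
    calc _ = ENNReal.ofReal (R ^ N) * ENNReal.ofReal ((R ^ N)⁻¹) * ∫⁻ x in Metric.ball (0 : EuclideanSpace ℝ (Fin N)) R, ENNReal.ofReal (‖x‖ ^ (-γ)) := by rw [h3, one_mul]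
      _ = _ := by
        rw [mul_assoc, ← h1, ← mul_assoc, ← ENNReal.ofReal_mul (by positivity), mul_comm,
          sub_eq_add_neg, Real.rpow_add hR, Real.rpow_natCast]

lemma wse_exp_rpow (a y : ℝ) : ENNReal.ofReal (Real.exp a) ^ y = ENNReal.ofReal (Real.exp (a * y)) := by
  rw [ENNReal.ofReal_rpow_of_pos (Real.exp_pos a), ← Real.exp_mul]

lemma wse_exists_exp {M : ℝ≥0∞} (h0 : M ≠ 0) (ht : M ≠ ⊤) : ∃ a : ℝ, M = ENNReal.ofReal (Real.exp a) :=
  ⟨Real.log M.toReal, by rw [Real.exp_log (ENNReal.toReal_pos h0 ht), ENNReal.ofReal_toReal ht]⟩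

lemma wse_holder {α : Type*} [MeasurableSpace α] {μ : Measure α} {f : α → ℝ≥0∞}
    (hf : Measurable f) {q t s y z : ℝ} (hq : 0 ≤ q) (ht : 0 ≤ t) (hy : 0 ≤ y) (hz : 0 ≤ z)
    (hyz : y + z = 1) (hs : q * y + t * z = s) :
    ∫⁻ x, f x ^ s ∂μ ≤ (∫⁻ x, f x ^ q ∂μ) ^ y * (∫⁻ x, f x ^ t ∂μ) ^ z := by
  have := ENNReal.lintegral_mul_norm_pow_le (μ := μ) (f := fun x => f x ^ q) (g := fun x => f x ^ t)
    (by fun_prop) (by fun_prop) hy hz hyz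
  refine le_of_eq_of_le (lintegral_congr fun x => ?_) this
  rw [← ENNReal.rpow_mul, ← ENNReal.rpow_mul, ← ENNReal.rpow_add_of_nonneg _ _ (by positivity) (by positivity), hs]

lemma wse_holder3 {α : Type*} [MeasurableSpace α] {μ : Measure α} {f g : α → ℝ≥0∞}
    (hf : Measurable f) (hg : Measurable g) {q t s x y z : ℝ} (hq : 0 ≤ q) (ht : 0 ≤ t) (hx : 0 ≤ x)
    (hy : 0 ≤ y) (hz : 0 ≤ z)
    (hyz : x + y + z = 1) (hs : q * y + t * z = s) :
    ∫⁻ a, g a ^ x * f a ^ s ∂μ ≤ (∫⁻ a, g a ∂μ) ^ x * (∫⁻ a, f a ^ q ∂μ) ^ y * (∫⁻ a, f a ^ t ∂μ) ^ z := by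
  have := ENNReal.lintegral_prod_norm_pow_le (μ := μ) Finset.univ
    (f := ![g, fun a => f a ^ q, fun a => f a ^ t]) (p := ![x, y, z])
    (by intro i _; fin_cases i <;> simp <;> fun_prop) (by simp [Fin.sum_univ_three, hyz])
    (by intro i _; fin_cases i <;> simpa)
  simp only [Fin.prod_univ_three, Matrix.cons_val_zero, Matrix.cons_val_one, Matrix.cons_val] at this
  refine le_of_eq_of_le (lintegral_congr fun a => ?_) this
  rw [← ENNReal.rpow_mul, ← ENNReal.rpow_mul, mul_assoc, ← ENNReal.rpow_add_of_nonneg _ _ (by positivity) (by positivity), hs]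

lemma wse_interp (N : ℕ) (hN : 1 ≤ N) (σ t x : ℝ) (hσ : σ < 0) (hx : 0 < x) (hγ : -σ / x < N) :
    ∃ K : ℝ≥0∞, K ≠ ⊤ ∧ ∀ (f : EuclideanSpace ℝ (Fin N) → ℝ≥0∞) (q s y z y' z' : ℝ),
      Measurable f → 0 < q → q < t → 0 ≤ y → 0 ≤ z → 0 ≤ y' → 0 ≤ z' → x + y + z = 1 →
      q * y + t * z = s → y' + z' = 1 → q * y' + t * z' = s →
      (∫⁻ a, f a ^ q) ≠ 0 → (∫⁻ a, f a ^ q) ≠ ⊤ → (∫⁻ a, f a ^ t) ≠ 0 → (∫⁻ a, f a ^ t) ≠ ⊤ →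
      ∫⁻ a, ENNReal.ofReal (‖a‖ ^ σ) * f a ^ s ≤
        K * (∫⁻ a, f a ^ q) ^ (y' + σ * t / (N * (t - q))) *
          (∫⁻ a, f a ^ t) ^ (z' - σ * q / (N * (t - q))) := by
  obtain ⟨C, hC, hball⟩ := wse_ball_int N hN (-σ / x) hγ
  refine ⟨C ^ x + 1, by finiteness, ?_⟩
  intro f q s y z y' z' hf hq hqt hy hz hy' hz' h1 h2 h3 h4 hM0 hMt hT0 hTt
  have hNpos : (0 : ℝ) < N := by exact_mod_cast hN
  have htq : 0 < t - q := by linarith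
  obtain ⟨a, ha⟩ := wse_exists_exp hM0 hMt
  obtain ⟨b, hb⟩ := wse_exists_exp hT0 hTt
  set R : ℝ := Real.exp ((t * a - q * b) / (N * (t - q))) with hR
  have hRpos : 0 < R := Real.exp_pos _
  have hgm : Measurable fun a : EuclideanSpace ℝ (Fin N) => ENNReal.ofReal (‖a‖ ^ (-(-σ / x))) := by
    fun_prop
  rw [← lintegral_add_compl _ (measurableSet_ball (x := (0 : EuclideanSpace ℝ (Fin N))) (ε := R))]
  have hin : ∫⁻ a in Metric.ball (0 : EuclideanSpace ℝ (Fin N)) R, ENNReal.ofReal (‖a‖ ^ σ) * f a ^ s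
      ≤ (C * ENNReal.ofReal (R ^ (N - -σ / x))) ^ x * (∫⁻ a, f a ^ q) ^ y * (∫⁻ a, f a ^ t) ^ z := by
    have := wse_holder3 (μ := volume.restrict (Metric.ball (0 : EuclideanSpace ℝ (Fin N)) R)) hf hgm
      hq.le (by linarith : 0 ≤ t) hx.le hy hz h1 h2
    calc _ = ∫⁻ a in Metric.ball (0 : EuclideanSpace ℝ (Fin N)) R,
          ENNReal.ofReal (‖a‖ ^ (-(-σ / x))) ^ x * f a ^ s := by
          refine lintegral_congr fun a => ?_
          rw [ENNReal.ofReal_rpow_of_nonneg (by positivity) hx.le, ← Real.rpow_mul (norm_nonneg _)]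
          congr 4
          field_simp
      _ ≤ _ := this
      _ ≤ _ := by
        gcongr
        · exact hball R hRpos
        · exact Measure.restrict_le_self
        · exact Measure.restrict_le_self
  have hout : ∫⁻ a in (Metric.ball (0 : EuclideanSpace ℝ (Fin N)) R)ᶜ, ENNReal.ofReal (‖a‖ ^ σ) * f a ^ s
      ≤ ENNReal.ofReal (R ^ σ) * ((∫⁻ a, f a ^ q) ^ y' * (∫⁻ a, f a ^ t) ^ z') := by
    calc _ ≤ ∫⁻ a in (Metric.ball (0 : EuclideanSpace ℝ (Fin N)) R)ᶜ, ENNReal.ofReal (R ^ σ) * f a ^ s := by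
          refine setLIntegral_mono' measurableSet_ball.compl fun a ha => ?_
          refine mul_le_mul' (ENNReal.ofReal_le_ofReal ?_) le_rfl
          refine Real.rpow_le_rpow_of_nonpos hRpos ?_ hσ.le
          simpa using ha
      _ ≤ ∫⁻ a, ENNReal.ofReal (R ^ σ) * f a ^ s := setLIntegral_le_lintegral _ _
      _ = ENNReal.ofReal (R ^ σ) * ∫⁻ a, f a ^ s := lintegral_const_mul' _ _ ENNReal.ofReal_ne_top
      _ ≤ _ := by
        gcongr
        exact wse_holder hf hq.le (by linarith) hy' hz' h3 h4
  refine (add_le_add hin hout).trans ?_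
  rw [ha, hb, ENNReal.mul_rpow_of_nonneg _ _ hx.le, hR, ← Real.exp_mul, ← Real.exp_mul]
  simp only [wse_exp_rpow]
  apply le_of_eq
  rw [add_mul, add_mul, one_mul]
  congr 1
  · simp only [mul_assoc]
    congr 1
    rw [← ENNReal.ofReal_mul (by positivity), ← ENNReal.ofReal_mul (by positivity),
      ← ENNReal.ofReal_mul (by positivity), ← Real.exp_add, ← Real.exp_add, ← Real.exp_add]
    congr 2
    have hy1 : y = 1 - x - z := by linarith
    have hz1 : z = (s - q * (1 - x)) / (t - q) := by
      rw [eq_div_iff htq.ne']; subst hy1; linarith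
    have hy1' : y' = 1 - z' := by linarith
    have hz1' : z' = (s - q) / (t - q) := by
      rw [eq_div_iff htq.ne']; subst hy1'; linarith
    rw [hy1, hz1, hy1', hz1']
    field_simp
    ring
  · rw [← ENNReal.ofReal_mul (by positivity), ← ENNReal.ofReal_mul (by positivity),
      ← ENNReal.ofReal_mul (by positivity), ← Real.exp_add, ← Real.exp_add, ← Real.exp_add]
    congr 2
    field_simp
    ring

lemma wse_contDiff_pow {N : ℕ} {V : EuclideanSpace ℝ (Fin N) → ℝ} (hV : ContDiff ℝ 1 V) {β : ℝ}
    (hβ : 1 ≤ β) : ContDiff ℝ 1 (fun x => V x ^ β) :=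
  ContDiff.rpow_const_of_le (m := 1) (by exact_mod_cast hV) (by exact_mod_cast hβ)

lemma wse_supp_pow {N : ℕ} {V : EuclideanSpace ℝ (Fin N) → ℝ} (hV : HasCompactSupport V) {β : ℝ}
    (hβ : 1 ≤ β) : HasCompactSupport (fun x => V x ^ β) :=
  hV.comp_left (g := fun y : ℝ => y ^ β) (Real.zero_rpow (by linarith))

lemma wse_enorm_pow {v β : ℝ} (hv : 0 ≤ v) (hβ : 0 ≤ β) : ‖v ^ β‖ₑ = ‖v‖ₑ ^ β := by
  rw [Real.enorm_of_nonneg hv, Real.enorm_of_nonneg (Real.rpow_nonneg hv _),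
    ENNReal.ofReal_rpow_of_nonneg hv hβ]

lemma wse_fderiv_pow {N : ℕ} {V : EuclideanSpace ℝ (Fin N) → ℝ} (hV : ContDiff ℝ 1 V)
    (h0 : ∀ x, 0 ≤ V x) {β : ℝ} (hβ : 1 ≤ β) (x) :
    ‖fderiv ℝ (fun x => V x ^ β) x‖ₑ = ENNReal.ofReal β * (‖V x‖ₑ ^ (β - 1) * ‖fderiv ℝ V x‖ₑ) := by
  have h1 : HasFDerivAt V (fderiv ℝ V x) x := (hV.differentiable one_ne_zero x).hasFDerivAt
  have h2 := (h1.rpow_const (p := β) (Or.inr hβ)).fderiv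
  rw [h2, enorm_smul, enorm_mul, wse_enorm_pow (h0 x) (by linarith), Real.enorm_of_nonneg (by linarith), mul_assoc]

lemma wse_int_fderiv_pow {N : ℕ} {V : EuclideanSpace ℝ (Fin N) → ℝ} (hV : ContDiff ℝ 1 V)
    (h0 : ∀ x, 0 ≤ V x) {β : ℝ} (hβ : 1 ≤ β) :
    (∫⁻ x, ‖fderiv ℝ (fun x => V x ^ β) x‖ₑ) ^ (2 : ℝ) ≤
      ENNReal.ofReal (β ^ 2) * (∫⁻ x, ‖V x‖ₑ ^ (2 * β - 2)) * ∫⁻ x, ‖fderiv ℝ V x‖ₑ ^ (2 : ℝ) := by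
  have hVm : Measurable fun x => ‖V x‖ₑ := hV.continuous.measurable.enorm
  have hDm : Measurable fun x => ‖fderiv ℝ V x‖ₑ := (hV.continuous_fderiv one_ne_zero).measurable.enorm
  have := ENNReal.lintegral_mul_norm_pow_le (μ := (volume : Measure (EuclideanSpace ℝ (Fin N))))
    (f := fun x => ‖V x‖ₑ ^ (2 * β - 2)) (g := fun x => ‖fderiv ℝ V x‖ₑ ^ (2 : ℝ))
    (hVm.pow_const _).aemeasurable (hDm.pow_const _).aemeasurable (p := 1 / 2) (q := 1 / 2) (by norm_num) (by norm_num) (by norm_num)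
  simp_rw [wse_fderiv_pow hV h0 hβ]
  rw [lintegral_const_mul' _ _ ENNReal.ofReal_ne_top, ENNReal.mul_rpow_of_nonneg _ _ (by norm_num), mul_assoc]
  gcongr
  · rw [ENNReal.ofReal_rpow_of_nonneg (by linarith) (by norm_num)]; norm_num
  · calc _ = (∫⁻ a, (‖V a‖ₑ ^ (2 * β - 2)) ^ (1 / 2 : ℝ) * (‖fderiv ℝ V a‖ₑ ^ (2 : ℝ)) ^ (1 / 2 : ℝ)) ^ (2 : ℝ) := by
          congr 1
          refine lintegral_congr fun x => ?_
          rw [← ENNReal.rpow_mul, ← ENNReal.rpow_mul]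
          norm_num
          congr 2; ring
      _ ≤ _ := ENNReal.rpow_le_rpow this (by norm_num)
      _ = _ := by
        rw [ENNReal.mul_rpow_of_nonneg _ _ (by norm_num), ← ENNReal.rpow_mul, ← ENNReal.rpow_mul]
        norm_num

/-- Gagliardo–Nirenberg at a suitable exponent. -/
def WSEGN (N : ℕ) (t : ℝ) : Prop := ∃ C : ℝ≥0∞, C ≠ ⊤ ∧
  ∀ (q : ℝ) (V : EuclideanSpace ℝ (Fin N) → ℝ), 0 < q → q < 2 → ContDiff ℝ 1 V →
    HasCompactSupport V → (∀ x, 0 ≤ V x) →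
    (∫⁻ a, ‖V a‖ₑ ^ q) ≠ 0 → (∫⁻ a, ‖V a‖ₑ ^ q) ≠ ⊤ → (∫⁻ a, ‖V a‖ₑ ^ t) ≠ 0 → (∫⁻ a, ‖V a‖ₑ ^ t) ≠ ⊤ →
    (∫⁻ a, ‖V a‖ₑ ^ t) ^ ((2 + 2 * q / N - q) / (t - q)) ≤
      C * (∫⁻ x, ‖fderiv ℝ V x‖ₑ ^ (2 : ℝ)) *
        (∫⁻ a, ‖V a‖ₑ ^ q) ^ ((2 + 2 * q / N - q) / (t - q) - ((N : ℝ) - 2) / N)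

lemma wse_gn_three (N : ℕ) (hN : 3 ≤ N) : WSEGN N (2 * N / (N - 2)) := by
  have hN' : (3 : ℝ) ≤ N := by exact_mod_cast hN
  have hN2 : (0 : ℝ) < N - 2 := by linarith
  set p' : NNReal := ⟨2 * N / (N - 2), by positivity⟩ with hp'
  have hp'v : (p' : ℝ) = 2 * N / (N - 2) := rfl
  have hp'0 : p' ≠ 0 := by
    intro h
    have : (p' : ℝ) = 0 := by rw [h]; rfl
    rw [hp'v] at this
    have : 0 < (2 * N / (N - 2) : ℝ) := by positivity
    linarith
  refine ⟨(SNormLESNormFDerivOfEqConst ℝ (volume : Measure (EuclideanSpace ℝ (Fin N))) (2 : NNReal) : ℝ≥0∞) ^ (2 : ℝ),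
    by finiteness, ?_⟩
  intro q V hq hq2 hV hVs h0 hM0 hMt hT0 hTt
  have h := eLpNorm_le_eLpNorm_fderiv_of_eq (volume : Measure (EuclideanSpace ℝ (Fin N))) hV hVs
    (p := 2) (p' := p') (by norm_num) (by simp; omega) (by
      rw [hp'v]; simp; field_simp)
  rw [eLpNorm_nnreal_eq_lintegral hp'0, eLpNorm_nnreal_eq_lintegral (by norm_num), hp'v] at h
  have h2 := ENNReal.rpow_le_rpow h (show (0 : ℝ) ≤ 2 by norm_num)
  rw [ENNReal.mul_rpow_of_nonneg _ _ (by norm_num), ← ENNReal.rpow_mul, ← ENNReal.rpow_mul] at h2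
  have hne : (2 : ℝ) * N / (N - 2) - q ≠ 0 := by
    have : 2 < (2 : ℝ) * N / (N - 2) := by rw [lt_div_iff₀ hN2]; linarith
    linarith
  have he : (2 + 2 * q / N - q) / ((2 : ℝ) * N / (N - 2) - q) = (N - 2) / N := by
    rw [div_eq_div_iff hne (by positivity)]
    field_simp
    ring
  rw [he, sub_self, ENNReal.rpow_zero, mul_one]
  convert h2 using 2
  · field_simp
  · norm_num

lemma wse_gn_two (t : ℝ) (ht : 4 ≤ t) : WSEGN 2 t := by
  have hconj : Real.HolderConjugate ((Module.finrank ℝ (EuclideanSpace ℝ (Fin 2)) : ℕ) : ℝ) 2 := by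
    simp only [finrank_euclideanSpace, Fintype.card_fin]
    exact_mod_cast Real.HolderConjugate.two_two
  refine ⟨lintegralPowLePowLIntegralFDerivConst (volume : Measure (EuclideanSpace ℝ (Fin 2))) 2 *
    ENNReal.ofReal ((t / 2) ^ 2), by finiteness, ?_⟩
  intro q V hq hq2 hV hVs h0 hM0 hMt hT0 hTt
  have hβ : 1 ≤ t / 2 := by linarith
  have hVm : Measurable fun x => ‖V x‖ₑ := hV.continuous.measurable.enorm
  have h1 := lintegral_pow_le_pow_lintegral_fderiv (volume : Measure (EuclideanSpace ℝ (Fin 2)))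
    (wse_contDiff_pow hV hβ) (wse_supp_pow hVs hβ) hconj
  have h2 := wse_int_fderiv_pow hV h0 hβ
  have htq : 0 < t - q := by linarith
  have h3 := wse_holder (μ := volume) hVm hq.le (by linarith : 0 ≤ t) (y := 2 / (t - q))
    (z := (t - 2 - q) / (t - q)) (s := 2 * (t / 2) - 2) (by positivity)
    (div_nonneg (by linarith) htq.le) (by field_simp; ring) (by field_simp; ring)
  have h4 : ∀ x, ‖V x ^ (t / 2)‖ₑ ^ (2 : ℝ) = ‖V x‖ₑ ^ t := by
    intro x
    rw [wse_enorm_pow (h0 x) (by linarith), ← ENNReal.rpow_mul]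
    congr 1; ring
  simp_rw [h4] at h1
  set T := ∫⁻ a, ‖V a‖ₑ ^ t
  set M := ∫⁻ a, ‖V a‖ₑ ^ q
  set D := ∫⁻ x, ‖fderiv ℝ V x‖ₑ ^ (2 : ℝ)
  set c := (lintegralPowLePowLIntegralFDerivConst (volume : Measure (EuclideanSpace ℝ (Fin 2))) 2 : ℝ≥0∞)
  have he : (2 + 2 * q / (2 : ℕ) - q) / (t - q) = 2 / (t - q) := by push_cast; congr 1; ring
  rw [he]
  norm_num only [sub_self, zero_div, sub_zero, Nat.cast_ofNat]
  have h5 : T ^ (2 / (t - q)) * T ^ ((t - 2 - q) / (t - q)) ≤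
      (c * ENNReal.ofReal ((t / 2) ^ 2) * D * M ^ (2 / (t - q))) * T ^ ((t - 2 - q) / (t - q)) := by
    rw [← ENNReal.rpow_add _ _ hT0 hTt]
    have : 2 / (t - q) + (t - 2 - q) / (t - q) = 1 := by field_simp; ring
    rw [this, ENNReal.rpow_one]
    calc T ≤ _ := h1
      _ ≤ c * (ENNReal.ofReal ((t / 2) ^ 2) * (M ^ (2 / (t - q)) * T ^ ((t - 2 - q) / (t - q))) * D) := by
        gcongr
        exact h2.trans (by gcongr)
      _ = _ := by ring
  refine (ENNReal.mul_le_mul_iff_left ?_ ?_).1 h5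
  · exact (ENNReal.rpow_pos (pos_iff_ne_zero.2 hT0) hTt).ne'
  · exact ENNReal.rpow_ne_top_of_ne_zero hT0 hTt

lemma wse_sup_one {u : EuclideanSpace ℝ (Fin 1) → ℝ} (hu : ContDiff ℝ 1 u) (hs : HasCompactSupport u) (x) :
    ‖u x‖ₑ ≤ ∫⁻ y, ‖fderiv ℝ u y‖ₑ := by
  let e : ℝ ≃ₗᵢ[ℝ] EuclideanSpace ℝ (Fin 1) := (OrthonormalBasis.singleton (Fin 1) ℝ).repr
  have hmp : MeasurePreserving e := e.measurePreserving
  have h1 : ContDiff ℝ 1 (u ∘ e) := hu.comp e.contDiff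
  have h2 : HasCompactSupport (u ∘ e) := hs.comp_isClosedEmbedding e.toHomeomorph.isClosedEmbedding
  have h3 := HasCompactSupport.enorm_le_lintegral_Ici_deriv h1 h2 (e.symm x)
  simp only [Function.comp_apply, LinearIsometryEquiv.apply_symm_apply] at h3
  refine h3.trans ?_
  refine (setLIntegral_le_lintegral _ _).trans ?_
  rw [← hmp.lintegral_comp_emb e.toHomeomorph.measurableEmbedding]
  refine lintegral_mono fun y => ?_
  have h4 : HasDerivAt e (e 1) y := by
    have := (e.toContinuousLinearEquiv : ℝ →L[ℝ] EuclideanSpace ℝ (Fin 1)).hasDerivAt (x := y)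
    simpa using this
  have h5 : HasDerivAt (u ∘ e) (fderiv ℝ u (e y) (e 1)) y :=
    (hu.differentiable one_ne_zero (e y)).hasFDerivAt.comp_hasDerivAt y h4
  rw [h5.deriv]
  refine (ContinuousLinearMap.le_opENorm _ _).trans ?_
  have : ‖e 1‖ₑ = 1 := by
    rw [← ofReal_norm, e.norm_map]; simp
  rw [this, mul_one]

lemma wse_gn_one (t : ℝ) (ht : 2 < t) : WSEGN 1 t := by
  refine ⟨4, by finiteness, ?_⟩
  intro q V hq hq2 hV hVs h0 hM0 hMt hT0 hTt
  have hβ : 1 ≤ 1 + q / 2 := by linarith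
  have hVm : Measurable fun x => ‖V x‖ₑ := hV.continuous.measurable.enorm
  have h2 := wse_int_fderiv_pow hV h0 hβ
  have e1 : 2 * (1 + q / 2) - 2 = q := by ring
  rw [e1] at h2
  have htq : 0 < t - q := by linarith
  set M := ∫⁻ a, ‖V a‖ₑ ^ q
  set D := ∫⁻ x, ‖fderiv ℝ V x‖ₑ ^ (2 : ℝ)
  have h3 : ∀ x, ‖V x‖ₑ ^ (2 + q) ≤ 4 * M * D := by
    intro x
    have h1 := wse_sup_one (wse_contDiff_pow hV hβ) (wse_supp_pow hVs hβ) x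
    have h1' := ENNReal.rpow_le_rpow h1 (show (0 : ℝ) ≤ 2 by norm_num)
    rw [wse_enorm_pow (h0 x) (by linarith), ← ENNReal.rpow_mul] at h1'
    have : (1 + q / 2) * 2 = 2 + q := by ring
    rw [this] at h1'
    refine h1'.trans (h2.trans ?_)
    gcongr
    rw [← ENNReal.ofReal_ofNat]
    apply ENNReal.ofReal_le_ofReal
    nlinarith
  have h4 : ∫⁻ a, ‖V a‖ₑ ^ t ≤ M * (4 * M * D) ^ ((t - q) / (2 + q)) := by
    calc ∫⁻ a, ‖V a‖ₑ ^ t ≤ ∫⁻ a, ‖V a‖ₑ ^ q * (4 * M * D) ^ ((t - q) / (2 + q)) := by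
          refine lintegral_mono fun x => ?_
          calc ‖V x‖ₑ ^ t = ‖V x‖ₑ ^ q * (‖V x‖ₑ ^ (2 + q)) ^ ((t - q) / (2 + q)) := by
                rw [← ENNReal.rpow_mul, ← ENNReal.rpow_add_of_nonneg _ _ hq.le
                  (by have : 0 < 2 + q := by linarith
                      positivity)]
                congr 1
                have : 2 + q ≠ 0 := by linarith
                field_simp
                ring
            _ ≤ _ := by
              gcongr
              exact h3 x
      _ = _ := lintegral_mul_const _ (by fun_prop)
  have hη : 0 < (2 + q) / (t - q) := div_pos (by linarith) htq
  have he : (2 + 2 * q / (1 : ℕ) - q) / (t - q) = (2 + q) / (t - q) := by push_cast; congr 1; ring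
  rw [he]
  refine (ENNReal.rpow_le_rpow h4 hη.le).trans (le_of_eq ?_)
  rw [ENNReal.mul_rpow_of_nonneg _ _ hη.le, ← ENNReal.rpow_mul]
  have e2 : (t - q) / (2 + q) * ((2 + q) / (t - q)) = 1 := by
    have : 2 + q ≠ 0 := by linarith
    field_simp
  have e3 : (2 + q) / (t - q) - (((1 : ℕ) : ℝ) - 2) / (1 : ℕ) = (2 + q) / (t - q) + 1 := by push_cast; ring
  rw [e2, e3, ENNReal.rpow_add _ _ hM0 hMt, ENNReal.rpow_one, ENNReal.rpow_one]
  ring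

lemma wse_exists_t (N : ℕ) (hN : 1 ≤ N) (σ : ℝ) (hσ2 : -2 < σ) (hσN : -(N : ℝ) < σ) (hσ : σ < 0) :
    ∃ t : ℝ, 2 < t ∧ 2 * N + 2 * (σ + 2) < t * (N + σ) ∧ WSEGN N t := by
  rcases (by omega : N = 1 ∨ N = 2 ∨ 3 ≤ N) with rfl | rfl | h3
  · have h1 : 0 < σ + 1 := by norm_num at hσN; linarith
    have h2 : 2 < (2 * σ + 6) / (σ + 1) := by rw [lt_div_iff₀ h1]; linarith
    refine ⟨(2 * σ + 6) / (σ + 1) + 1, by linarith, ?_, wse_gn_one _ (by linarith)⟩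
    push_cast
    have : ((2 * σ + 6) / (σ + 1) + 1) * (1 + σ) = 2 * σ + 6 + (σ + 1) := by field_simp; ring
    rw [this]; linarith
  · have h1 : 0 < σ + 2 := by linarith
    have h2 : 0 < 4 / (σ + 2) := by positivity
    refine ⟨4 / (σ + 2) + 4, by linarith, ?_, wse_gn_two _ (by linarith)⟩
    push_cast
    have : (4 / (σ + 2) + 4) * (2 + σ) = 4 + 4 * (σ + 2) := by field_simp; ring
    rw [this]; linarith
  · have hN' : (3 : ℝ) ≤ N := by exact_mod_cast h3
    have hN2 : (0 : ℝ) < N - 2 := by linarith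
    refine ⟨2 * N / (N - 2), ?_, ?_, wse_gn_three N h3⟩
    · rw [lt_div_iff₀ hN2]; linarith
    · rw [div_mul_eq_mul_div, lt_div_iff₀ hN2]
      nlinarith

lemma wse_core (N : ℕ) (hN : 1 ≤ N) (σ : ℝ) (hσ2 : -2 < σ) (hσN : -(N : ℝ) < σ) (hσ : σ < 0) :
    ∃ Λ : ℝ≥0∞, Λ ≠ ⊤ ∧ ∀ (q : ℝ) (V : EuclideanSpace ℝ (Fin N) → ℝ), 0 < q → q < 2 →
      ContDiff ℝ 1 V → HasCompactSupport V → (∀ x, 0 ≤ V x) →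
      ∫⁻ a, ENNReal.ofReal (‖a‖ ^ σ) * ‖V a‖ₑ ^ (2 + q * (σ + 2) / N) ≤
        Λ * (∫⁻ x, ‖fderiv ℝ V x‖ₑ ^ (2 : ℝ)) * (∫⁻ a, ‖V a‖ₑ ^ q) ^ ((σ + 2) / N) := by
  obtain ⟨t, ht2, htc, C, hC, hGN⟩ := wse_exists_t N hN σ hσ2 hσN hσ
  have hNpos : (0 : ℝ) < N := by exact_mod_cast hN
  have htpos : 0 < t := by linarith
  have hNt : 0 < N * t := by positivity
  set x : ℝ := 1 - (2 * N + 2 * (σ + 2)) / (N * t) with hx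
  have hlt : 2 * N + 2 * (σ + 2) < N * t := by nlinarith
  have hx0 : 0 < x := by
    rw [hx, sub_pos, div_lt_one hNt]; exact hlt
  have hx1 : 1 - x = (2 * N + 2 * (σ + 2)) / (N * t) := by rw [hx]; ring
  have hγ : -σ / x < N := by
    rw [div_lt_iff₀ hx0, hx, mul_sub, mul_one, ← sub_pos]
    have : N - N * ((2 * N + 2 * (σ + 2)) / (N * t)) - -σ = (t * (N + σ) - (2 * N + 2 * (σ + 2))) / t := by
      field_simp; ring
    rw [this]
    apply div_pos _ htpos
    linarith
  obtain ⟨K, hK, hint⟩ := wse_interp N hN σ t x hσ hx0 hγ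
  refine ⟨K * C, by finiteness, ?_⟩
  intro q V hq hq2 hV hVs h0
  have hVm : Measurable fun x => ‖V x‖ₑ := hV.continuous.measurable.enorm
  have hfin : ∀ a : ℝ, 0 < a → ∫⁻ x, ‖V x‖ₑ ^ a ≠ ⊤ := by
    intro a ha
    have h1 : Continuous fun x => V x ^ a := hV.continuous.rpow_const (fun _ => Or.inr ha.le)
    have h2 : HasCompactSupport fun x => V x ^ a :=
      hVs.comp_left (g := fun y : ℝ => y ^ a) (Real.zero_rpow ha.ne')
    have h3 := (h1.integrable_of_hasCompactSupport h2 (μ := volume)).2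
    rw [HasFiniteIntegral] at h3
    simp_rw [wse_enorm_pow (h0 _) ha.le] at h3
    exact h3.ne
  have hzero : (∀ᵐ a, ‖V a‖ₑ = 0) → ∫⁻ a, ENNReal.ofReal (‖a‖ ^ σ) * ‖V a‖ₑ ^ (2 + q * (σ + 2) / N) = 0 := by
    intro h
    have hs : 0 < 2 + q * (σ + 2) / N := by
      have : 0 < σ + 2 := by linarith
      positivity
    rw [lintegral_eq_zero_iff (by fun_prop)]
    filter_upwards [h] with a ha
    simp only [ha, ENNReal.zero_rpow_of_pos hs, mul_zero, Pi.zero_apply]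
  have hzero' : ∀ a : ℝ, 0 < a → ∫⁻ x, ‖V x‖ₑ ^ a = 0 → (∀ᵐ a, ‖V a‖ₑ = 0) := by
    intro a ha h
    rw [lintegral_eq_zero_iff (hVm.pow_const _)] at h
    filter_upwards [h] with y hy
    exact (ENNReal.rpow_eq_zero_iff_of_pos ha).1 hy
  by_cases hM0 : ∫⁻ x, ‖V x‖ₑ ^ q = 0
  · rw [hzero (hzero' q hq hM0)]; exact zero_le
  by_cases hT0 : ∫⁻ x, ‖V x‖ₑ ^ t = 0
  · rw [hzero (hzero' t htpos hT0)]; exact zero_le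
  have hMt := hfin q hq
  have hTt := hfin t htpos
  have htq : 0 < t - q := by linarith
  have hσ3 : 0 < σ + 2 := by linarith
  set s := 2 + q * (σ + 2) / N with hs
  have hNs : N * s = 2 * N + q * (σ + 2) := by rw [hs]; field_simp
  have hst : s ≤ t * (1 - x) := by
    rw [hx1]
    have : t * ((2 * N + 2 * (σ + 2)) / (N * t)) = (2 * N + 2 * (σ + 2)) / N := by field_simp
    rw [this, le_div_iff₀ hNpos]
    nlinarith
  have hst' : s ≤ t := by nlinarith
  have hqs : q ≤ s := by
    have : 0 < q * (σ + 2) / N := by positivity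
    linarith
  have h1 := hint (fun a => ‖V a‖ₑ) q s ((t * (1 - x) - s) / (t - q)) ((s - q * (1 - x)) / (t - q))
    ((t - s) / (t - q)) ((s - q) / (t - q)) hVm hq (by linarith)
    (div_nonneg (by linarith) htq.le) (div_nonneg (by nlinarith) htq.le)
    (div_nonneg (by linarith) htq.le) (div_nonneg (by linarith) htq.le)
    (by field_simp; ring) (by field_simp; ring) (by field_simp; ring) (by field_simp; ring)
    hM0 hMt hT0 hTt
  have h2 := hGN q V hq hq2 hV hVs h0 hM0 hMt hT0 hTt
  have e1 : (s - q) / (t - q) - σ * q / (N * (t - q)) = (2 + 2 * q / N - q) / (t - q) := by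
    rw [hs]; field_simp; ring
  rw [e1] at h1
  set M := ∫⁻ a, ‖V a‖ₑ ^ q
  set D := ∫⁻ x, ‖fderiv ℝ V x‖ₑ ^ (2 : ℝ)
  refine h1.trans ((mul_le_mul' le_rfl h2).trans (le_of_eq ?_))
  have e2 : (σ + 2) / N = ((t - s) / (t - q) + σ * t / (N * (t - q))) +
      ((2 + 2 * q / N - q) / (t - q) - ((N : ℝ) - 2) / N) := by
    rw [hs]; field_simp; ring
  rw [e2, ENNReal.rpow_add ((t - s) / (t - q) + σ * t / (N * (t - q))) _ hM0 hMt]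
  generalize M ^ ((t - s) / (t - q) + σ * t / (N * (t - q))) = A
  generalize M ^ ((2 + 2 * q / N - q) / (t - q) - ((N : ℝ) - 2) / N) = B
  ring

/-- A cutoff sequence with gradients of size `c / R`. -/
lemma wse_cutoff (N : ℕ) : ∃ c : ℝ, 0 ≤ c ∧ ∀ R : ℝ, 0 < R →
    ∃ χ : EuclideanSpace ℝ (Fin N) → ℝ, ContDiff ℝ 1 χ ∧ HasCompactSupport χ ∧
      (∀ x, 0 ≤ χ x) ∧ (∀ x, χ x ≤ 1) ∧ (∀ x, ‖x‖ ≤ R → χ x = 1) ∧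
      ∀ x, ‖fderiv ℝ χ x‖ ≤ c / R := by
  let b : ContDiffBump (0 : EuclideanSpace ℝ (Fin N)) := ⟨1, 2, by norm_num, by norm_num⟩
  have hb : ContDiff ℝ 1 b := b.contDiff
  obtain ⟨c, hc⟩ := (hb.continuous_fderiv one_ne_zero).bounded_above_of_compact_support
    (b.hasCompactSupport.fderiv (𝕜 := ℝ))
  refine ⟨c, (norm_nonneg _).trans (hc 0), fun R hR => ?_⟩
  refine ⟨fun x => b (R⁻¹ • x), hb.comp (contDiff_const_smul _), ?_, fun x => b.nonneg,
    fun x => b.le_one, ?_, ?_⟩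
  · exact b.hasCompactSupport.comp_homeomorph (Homeomorph.smulOfNeZero R⁻¹ (inv_ne_zero hR.ne'))
  · intro x hx
    apply b.one_of_mem_closedBall
    rw [mem_closedBall_zero_iff, norm_smul, norm_inv, Real.norm_of_nonneg hR.le]
    change R⁻¹ * ‖x‖ ≤ 1
    rw [inv_mul_le_iff₀ hR]; linarith
  · intro x
    have h1 : HasFDerivAt (fun x : EuclideanSpace ℝ (Fin N) => R⁻¹ • x)
        (R⁻¹ • ContinuousLinearMap.id ℝ _) x := (hasFDerivAt_id x).const_smul R⁻¹
    have h2 := ((hb.differentiable one_ne_zero (R⁻¹ • x)).hasFDerivAt.comp x h1).fderiv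
    change ‖fderiv ℝ (b ∘ fun x => R⁻¹ • x) x‖ ≤ _
    rw [h2, ContinuousLinearMap.comp_smul, norm_smul, norm_inv, Real.norm_of_nonneg hR.le,
      ContinuousLinearMap.comp_id, div_eq_inv_mul]
    gcongr
    exact hc _

lemma wse_fderiv_trunc {N : ℕ} {W : EuclideanSpace ℝ (Fin N) → ℝ} (hW : ContDiff ℝ 1 W)
    (h0 : ∀ x, 0 ≤ W x) {K : ℝ} (hK : 0 < K) :
    ContDiff ℝ 1 (fun x => K * W x / (K + W x)) ∧
    ∀ x, ‖fderiv ℝ (fun x => K * W x / (K + W x)) x‖ ≤ ‖fderiv ℝ W x‖ := by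
  have hne : ∀ x, K + W x ≠ 0 := fun x => by have := h0 x; positivity
  refine ⟨(contDiff_const.mul hW).div (contDiff_const.add hW) hne, fun x => ?_⟩
  have h1 : HasFDerivAt W (fderiv ℝ W x) x := (hW.differentiable one_ne_zero x).hasFDerivAt
  have h2 : HasDerivAt (fun y : ℝ => K * y / (K + y)) (K ^ 2 / (K + W x) ^ 2) (W x) := by
    have := ((hasDerivAt_id (W x)).const_mul K).div ((hasDerivAt_id (W x)).const_add K) (hne x)
    refine this.congr_deriv ?_
    simp only [id]
    congr 1
    ring
  have h3 := (h2.comp_hasFDerivAt x h1).fderiv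
  change ‖fderiv ℝ ((fun y : ℝ => K * y / (K + y)) ∘ W) x‖ ≤ _
  rw [h3, norm_smul, Real.norm_of_nonneg (by positivity)]
  have h4 : K ^ 2 / (K + W x) ^ 2 ≤ 1 := by
    have := h0 x
    rw [div_le_one (by positivity)]
    gcongr
    linarith
  exact mul_le_of_le_one_left (norm_nonneg _) h4

lemma wse_main (N : ℕ) (hN : 1 ≤ N) (σ : ℝ) (hσ2 : -2 < σ) (hσN : -(N : ℝ) < σ) (hσ : σ < 0) :
    ∃ Λ : ℝ≥0∞, Λ ≠ ⊤ ∧ ∀ (q : ℝ) (W : EuclideanSpace ℝ (Fin N) → ℝ), 0 < q → q < 2 →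
      ContDiff ℝ 1 W → (∀ x, 0 ≤ W x) → (∫⁻ a, ‖W a‖ₑ ^ q) ≠ ⊤ →
      ∫⁻ a, ENNReal.ofReal (‖a‖ ^ σ) * ‖W a‖ₑ ^ (2 + q * (σ + 2) / N) ≤
        Λ * (∫⁻ x, ‖fderiv ℝ W x‖ₑ ^ (2 : ℝ)) * (∫⁻ a, ‖W a‖ₑ ^ q) ^ ((σ + 2) / N) := by
  obtain ⟨Λ, hΛ, hcore⟩ := wse_core N hN σ hσ2 hσN hσ
  obtain ⟨c, hc0, hcut⟩ := wse_cutoff N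
  refine ⟨Λ * 2, by finiteness, ?_⟩
  intro q W hq hq2 hW h0 hMt
  have hNpos : (0 : ℝ) < N := by exact_mod_cast hN
  have hσ3 : 0 < σ + 2 := by linarith
  set s := 2 + q * (σ + 2) / N with hs
  have hspos : 0 < s := by positivity
  have hRn : ∀ n : ℕ, (0 : ℝ) < ((n : ℝ) + 1) ^ 2 := fun n => by positivity
  choose χ hχC hχs hχ0 hχ1 hχe hχd using fun n : ℕ => hcut (((n : ℝ) + 1) ^ 2) (hRn n)
  let U : ℕ → EuclideanSpace ℝ (Fin N) → ℝ := fun n x => ((n : ℝ) + 1) * W x / (((n : ℝ) + 1) + W x)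
  have hU := fun n : ℕ => wse_fderiv_trunc hW h0 (K := (n : ℝ) + 1) (by positivity)
  have hUC : ∀ n, ContDiff ℝ 1 (U n) := fun n => (hU n).1
  have hUd : ∀ n x, ‖fderiv ℝ (U n) x‖ ≤ ‖fderiv ℝ W x‖ := fun n => (hU n).2
  have hU0 : ∀ n x, 0 ≤ U n x := fun n x => by have := h0 x; positivity
  have hUW : ∀ n x, U n x ≤ W x := fun n x => by
    have := h0 x
    simp only [U]
    rw [div_le_iff₀ (by positivity)]
    nlinarith
  have hUn : ∀ n x, U n x ≤ (n : ℝ) + 1 := fun n x => by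
    have := h0 x
    simp only [U]
    rw [div_le_iff₀ (by positivity)]
    have : (0 : ℝ) ≤ n := by positivity
    nlinarith
  let V : ℕ → EuclideanSpace ℝ (Fin N) → ℝ := fun n x => χ n x * U n x
  have hVC : ∀ n, ContDiff ℝ 1 (V n) := fun n => (hχC n).mul (hUC n)
  have hV0 : ∀ n x, 0 ≤ V n x := fun n x => mul_nonneg (hχ0 n x) (hU0 n x)
  have hVs : ∀ n, HasCompactSupport (V n) := fun n => (hχs n).mul_right
  have hVW : ∀ n x, V n x ≤ W x := fun n x =>
    (mul_le_of_le_one_left (hU0 n x) (hχ1 n x)).trans (hUW n x)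
  have hVWe : ∀ n x, ‖V n x‖ₑ ≤ ‖W x‖ₑ := fun n x => by
    rw [Real.enorm_of_nonneg (hV0 n x), Real.enorm_of_nonneg (h0 x)]
    exact ENNReal.ofReal_le_ofReal (hVW n x)
  -- pointwise gradient bound
  have hgrad : ∀ n x, ‖fderiv ℝ (V n) x‖ₑ ^ (2 : ℝ) ≤
      2 * ‖fderiv ℝ W x‖ₑ ^ (2 : ℝ) + ENNReal.ofReal (2 * c ^ 2 / ((n : ℝ) + 1)) * ‖W x‖ₑ ^ q := by
    intro n x
    have hn1 : (1 : ℝ) ≤ (n : ℝ) + 1 := by have : (0 : ℝ) ≤ n := by positivity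
                                           linarith
    have hd : ‖fderiv ℝ (V n) x‖ ≤ ‖fderiv ℝ W x‖ + c / ((n : ℝ) + 1) ^ 2 * U n x := by
      have h1 : HasFDerivAt (χ n) (fderiv ℝ (χ n) x) x :=
        ((hχC n).differentiable one_ne_zero x).hasFDerivAt
      have h2 : HasFDerivAt (U n) (fderiv ℝ (U n) x) x :=
        ((hUC n).differentiable one_ne_zero x).hasFDerivAt
      have h3 := (h1.mul h2).fderiv
      change ‖fderiv ℝ (χ n * U n) x‖ ≤ _
      rw [h3]
      refine (norm_add_le _ _).trans ?_
      rw [norm_smul, norm_smul, Real.norm_of_nonneg (hχ0 n x), Real.norm_of_nonneg (hU0 n x)]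
      refine add_le_add ?_ ?_
      · exact (mul_le_of_le_one_left (norm_nonneg _) (hχ1 n x)).trans (hUd n x)
      · rw [mul_comm]
        exact mul_le_mul_of_nonneg_right (hχd n x) (hU0 n x)
    have hUq : U n x ^ 2 ≤ ((n : ℝ) + 1) ^ 2 * W x ^ q := by
      rcases (hU0 n x).eq_or_lt with h | h
      · rw [← h, zero_pow two_ne_zero]; have := h0 x; positivity
      · have e : U n x ^ 2 = U n x ^ (2 - q) * U n x ^ q := by
          rw [← Real.rpow_add h]; norm_num
        rw [e]
        have := h0 x
        gcongr
        · calc U n x ^ (2 - q) ≤ ((n : ℝ) + 1) ^ (2 - q) := by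
                exact Real.rpow_le_rpow h.le (hUn n x) (by linarith)
            _ ≤ ((n : ℝ) + 1) ^ (2 : ℝ) := Real.rpow_le_rpow_of_exponent_le hn1 (by linarith)
            _ = _ := by norm_num
        · exact hUW n x
    have hreal : ‖fderiv ℝ (V n) x‖ ^ 2 ≤ 2 * ‖fderiv ℝ W x‖ ^ 2 + 2 * c ^ 2 / ((n : ℝ) + 1) * W x ^ q := by
      have hWq : 0 ≤ W x ^ q := Real.rpow_nonneg (h0 x) _
      calc _ ≤ (‖fderiv ℝ W x‖ + c / ((n : ℝ) + 1) ^ 2 * U n x) ^ 2 := by gcongr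
        _ ≤ 2 * ‖fderiv ℝ W x‖ ^ 2 + 2 * (c / ((n : ℝ) + 1) ^ 2) ^ 2 * U n x ^ 2 := by
          nlinarith [sq_nonneg (‖fderiv ℝ W x‖ - c / ((n : ℝ) + 1) ^ 2 * U n x)]
        _ ≤ 2 * ‖fderiv ℝ W x‖ ^ 2 + 2 * (c / ((n : ℝ) + 1) ^ 2) ^ 2 * (((n : ℝ) + 1) ^ 2 * W x ^ q) := by
          gcongr
        _ = 2 * ‖fderiv ℝ W x‖ ^ 2 + 2 * c ^ 2 / ((n : ℝ) + 1) ^ 2 * W x ^ q := by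
          field_simp
        _ ≤ _ := by
          gcongr
          nlinarith
    have hWq : 0 ≤ W x ^ q := Real.rpow_nonneg (h0 x) _
    have hl : ∀ L : EuclideanSpace ℝ (Fin N) →L[ℝ] ℝ, ‖L‖ₑ ^ (2 : ℝ) = ENNReal.ofReal (‖L‖ ^ 2) := by
      intro L
      rw [← ofReal_norm, ENNReal.ofReal_rpow_of_nonneg (norm_nonneg _) (by norm_num)]
      norm_num
    have h22 : (2 : ℝ≥0∞) * ENNReal.ofReal (‖fderiv ℝ W x‖ ^ 2) =
        ENNReal.ofReal (2 * ‖fderiv ℝ W x‖ ^ 2) := by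
      rw [ENNReal.ofReal_mul (by norm_num), ENNReal.ofReal_ofNat]
    rw [hl, hl, h22, ← wse_enorm_pow (h0 x) hq.le, Real.enorm_of_nonneg hWq,
      ← ENNReal.ofReal_mul (by positivity),
      ← ENNReal.ofReal_add (by positivity) (by positivity)]
    exact ENNReal.ofReal_le_ofReal hreal
  set M := ∫⁻ a, ‖W a‖ₑ ^ q with hM
  set D := ∫⁻ x, ‖fderiv ℝ W x‖ₑ ^ (2 : ℝ) with hD
  have hWm : Measurable fun x => ‖W x‖ₑ := hW.continuous.measurable.enorm
  have hDm : Measurable fun x => ‖fderiv ℝ W x‖ₑ := (hW.continuous_fderiv one_ne_zero).measurable.enorm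
  have hbound : ∀ n : ℕ, ∫⁻ a, ENNReal.ofReal (‖a‖ ^ σ) * ‖V n a‖ₑ ^ s ≤
      Λ * (2 * D + ENNReal.ofReal (2 * c ^ 2 / ((n : ℝ) + 1)) * M) * M ^ ((σ + 2) / N) := by
    intro n
    refine (hcore q (V n) hq hq2 (hVC n) (hVs n) (hV0 n)).trans ?_
    gcongr
    · refine (lintegral_mono (hgrad n)).trans (le_of_eq ?_)
      rw [lintegral_add_left ((hDm.pow_const _).const_mul _), lintegral_const_mul _ (hDm.pow_const _),
        lintegral_const_mul _ (hWm.pow_const _)]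
    · exact lintegral_mono fun a => ENNReal.rpow_le_rpow (hVWe n a) hq.le
  have hptw : ∀ a, Filter.Tendsto (fun n => ENNReal.ofReal (‖a‖ ^ σ) * ‖V n a‖ₑ ^ s) Filter.atTop
      (nhds (ENNReal.ofReal (‖a‖ ^ σ) * ‖W a‖ₑ ^ s)) := by
    intro a
    apply ENNReal.Tendsto.const_mul _ (Or.inr ENNReal.ofReal_ne_top)
    apply ((ENNReal.continuous_rpow_const (y := s)).tendsto _).comp
    apply (continuous_enorm.tendsto _).comp
    have hn : Filter.Tendsto (fun n : ℕ => (n : ℝ) + 1) Filter.atTop Filter.atTop :=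
      Filter.tendsto_atTop_add_const_right _ _ tendsto_natCast_atTop_atTop
    have h1 : Filter.Tendsto (fun n => U n a) Filter.atTop (nhds (W a)) := by
      have h2 : Filter.Tendsto (fun n : ℕ => W a / (1 + W a / ((n : ℝ) + 1))) Filter.atTop
          (nhds (W a / (1 + 0))) :=
        tendsto_const_nhds.div (tendsto_const_nhds.add (hn.const_div_atTop _)) (by norm_num)
      rw [add_zero, div_one] at h2
      refine h2.congr fun n => ?_
      have := h0 a
      simp only [U]
      field_simp
    refine h1.congr' ?_
    filter_upwards [hn.eventually_ge_atTop (max 1 ‖a‖)] with n hn'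
    have h1' : 1 ≤ (n : ℝ) + 1 := (le_max_left _ _).trans hn'
    have h2' : ‖a‖ ≤ (n : ℝ) + 1 := (le_max_right _ _).trans hn'
    simp only [V]
    rw [hχe n a (by nlinarith), one_mul]
  have hlim : Filter.Tendsto (fun n : ℕ => Λ * (2 * D + ENNReal.ofReal (2 * c ^ 2 / ((n : ℝ) + 1)) * M) *
      M ^ ((σ + 2) / N)) Filter.atTop (nhds (Λ * (2 * D + 0 * M) * M ^ ((σ + 2) / N))) := by
    have hMp : M ^ ((σ + 2) / N) ≠ ⊤ := ENNReal.rpow_ne_top_of_nonneg (by positivity) hMt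
    apply ENNReal.Tendsto.mul_const _ (Or.inr hMp)
    apply ENNReal.Tendsto.const_mul _ (Or.inr hΛ)
    apply tendsto_const_nhds.add
    apply ENNReal.Tendsto.mul_const _ (Or.inr hMt)
    have hn : Filter.Tendsto (fun n : ℕ => (n : ℝ) + 1) Filter.atTop Filter.atTop :=
      Filter.tendsto_atTop_add_const_right _ _ tendsto_natCast_atTop_atTop
    have := ENNReal.tendsto_ofReal (hn.const_div_atTop (2 * c ^ 2))
    simpa using this
  calc ∫⁻ a, ENNReal.ofReal (‖a‖ ^ σ) * ‖W a‖ₑ ^ s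
      = ∫⁻ a, Filter.liminf (fun n => ENNReal.ofReal (‖a‖ ^ σ) * ‖V n a‖ₑ ^ s) Filter.atTop :=
        lintegral_congr fun a => (hptw a).liminf_eq.symm
    _ ≤ Filter.liminf (fun n => ∫⁻ a, ENNReal.ofReal (‖a‖ ^ σ) * ‖V n a‖ₑ ^ s) Filter.atTop := by
        refine lintegral_liminf_le fun n => ?_
        have : Measurable fun x => ‖V n x‖ₑ := (hVC n).continuous.measurable.enorm
        fun_prop
    _ ≤ Filter.liminf (fun n : ℕ => Λ * (2 * D + ENNReal.ofReal (2 * c ^ 2 / ((n : ℝ) + 1)) * M) *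
      M ^ ((σ + 2) / N)) Filter.atTop := Filter.liminf_le_liminf (Filter.Eventually.of_forall hbound)
    _ = Λ * (2 * D + 0 * M) * M ^ ((σ + 2) / N) := hlim.liminf_eq
    _ = _ := by ring

/-- Proposition 5.1: the critical case `r₁ = r₀` of the weighted interpolation inequality. -/
theorem weighted_source_estimate_critical
    (N : ℕ) (hN : 1 ≤ N) (m p σ : ℝ) (hm : 1 < m) (hp : 1 < p)
    (hσl : max (-2) (-(N : ℝ)) < σ) (hσu : σ < 0)
    (hpF : m + (σ + 2) / N < p)
    (rbar : ℝ) (hrbar : (N : ℝ) * (p - m) / (σ + 2) - 1 < rbar) :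
    ∃ Λ : ℝ, 1 ≤ Λ ∧
      ∀ r : ℝ, (N : ℝ) * (p - m) / (σ + 2) - 1 ≤ r → r ≤ rbar →
        ∀ w : EuclideanSpace ℝ (Fin N) → ℝ, (∀ x, 0 ≤ w x) →
          (∫⁻ x, ENNReal.ofReal (w x ^ ((N : ℝ) * (p - m) / (σ + 2) - 1 + 1))) < ⊤ →
          ContDiff ℝ 1 (fun x => w x ^ ((m + r) / 2)) →
          (∫⁻ x, ENNReal.ofReal (‖gradient (fun y => w y ^ ((m + r) / 2)) x‖ ^ 2)) < ⊤ →
          (∫⁻ x, ENNReal.ofReal (‖x‖ ^ σ * w x ^ (p + r))) ≤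
            ENNReal.ofReal Λ
              * (∫⁻ x, ENNReal.ofReal (‖gradient (fun y => w y ^ ((m + r) / 2)) x‖ ^ 2))
              * (∫⁻ x, ENNReal.ofReal (w x ^ ((N : ℝ) * (p - m) / (σ + 2) - 1 + 1))) ^
                  ((σ + 2) / N) := by
  have hσ2 : -2 < σ := (le_max_left _ _).trans_lt hσl
  have hσN : -(N : ℝ) < σ := (le_max_right _ _).trans_lt hσl
  have hNpos : (0 : ℝ) < N := by exact_mod_cast hN
  have hσ3 : 0 < σ + 2 := by linarith
  obtain ⟨Λ, hΛ, hmain⟩ := wse_main N hN σ hσ2 hσN hσu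
  refine ⟨max 1 Λ.toReal, le_max_left _ _, ?_⟩
  intro r hr _ w hw hM hW _
  set r1 : ℝ := (N : ℝ) * (p - m) / (σ + 2) - 1 + 1 with hr1
  have hpm : (σ + 2) / N < p - m := by linarith
  have hr1' : r1 = (N : ℝ) * (p - m) / (σ + 2) := by rw [hr1]; ring
  have hr1pos : 1 < r1 := by
    rw [hr1', lt_div_iff₀ hσ3, one_mul]
    rw [div_lt_iff₀ hNpos] at hpm
    linarith
  have hrr : r1 ≤ r + 1 := by linarith
  have hmr : 0 < m + r := by linarith
  have hpm' : p - m = r1 * (σ + 2) / N := by rw [hr1']; field_simp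
  set q : ℝ := 2 * r1 / (m + r) with hq
  have hq0 : 0 < q := by positivity
  have hq2 : q < 2 := by rw [hq, div_lt_iff₀ hmr]; linarith
  set W : EuclideanSpace ℝ (Fin N) → ℝ := fun x => w x ^ ((m + r) / 2) with hWdef
  have hW0 : ∀ x, 0 ≤ W x := fun x => Real.rpow_nonneg (hw x) _
  have e1 : ∀ x, ENNReal.ofReal (w x ^ r1) = ‖W x‖ₑ ^ q := by
    intro x
    rw [← wse_enorm_pow (hW0 x) hq0.le, Real.enorm_of_nonneg (Real.rpow_nonneg (hW0 x) _), hWdef]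
    simp only
    rw [← Real.rpow_mul (hw x)]
    congr 2
    rw [hq]; field_simp
  have hs : 0 < 2 + q * (σ + 2) / N := by positivity
  have e2 : ∀ x, ENNReal.ofReal (‖x‖ ^ σ * w x ^ (p + r)) =
      ENNReal.ofReal (‖x‖ ^ σ) * ‖W x‖ₑ ^ (2 + q * (σ + 2) / N) := by
    intro x
    rw [← wse_enorm_pow (hW0 x) hs.le, Real.enorm_of_nonneg (Real.rpow_nonneg (hW0 x) _), hWdef]
    simp only
    rw [← Real.rpow_mul (hw x), ENNReal.ofReal_mul (by positivity)]
    congr 3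
    have : p = m + r1 * (σ + 2) / N := by linarith
    rw [this, hq]; field_simp; ring
  have e3 : ∀ x, ENNReal.ofReal (‖gradient W x‖ ^ 2) = ‖fderiv ℝ W x‖ₑ ^ (2 : ℝ) := by
    intro x
    rw [← ofReal_norm, ENNReal.ofReal_rpow_of_nonneg (norm_nonneg _) (by norm_num), gradient,
      LinearIsometryEquiv.norm_map]
    norm_num
  simp_rw [e1] at hM ⊢
  simp_rw [e2, e3]
  refine (hmain q W hq0 hq2 hW hW0 hM.ne).trans ?_
  gcongr
  calc Λ = ENNReal.ofReal Λ.toReal := (ENNReal.ofReal_toReal hΛ).symm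
    _ ≤ _ := ENNReal.ofReal_le_ofReal (le_max_right _ _)
end
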